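/- Let E be an archimedean spectral effect algebra and a ∈ E. Then the rational spectral resolution of a is the unique family {p_λ}_{λ∈ℚ∩[0,1]} of projections such that: (i) p_λ ∈ PC(a) for all λ; (ii) p_0 ≤ a', p_1 = 1, and λ ≤ μ implies p_λ ≤ p_μ; (iii) ⋀_{λ<μ} p_μ = p_λ for all λ; (iv) for every binary string w, setting u_w := p_{λ(w+1)} ∧ p_{λ(w)}' (where w+1 denotes the lexicographic successor of w in {0,1}^{l(w)}, with λ(w+1) = 1 when w = 1…1), the element f_w(J_{u_w}(a)) exists in the effect algebra [0,u_w], where f_w denotes the composition f_{w_{l(w)}} ∘ … ∘ f_{w_1} of the partial maps f_0(b) = 2b (defined when b ≤ b') and f_1(b) = (2b')' (defined when b' ≤ b), taken in [0,u_w]. -/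

import Mathlib

/- Common definitions: effect algebras, compression bases, spectrality -/

attribute [local instance 0] Classical.propDecidable

universe u

structure EffectAlgebra (E : Type u) where
  padd : E → E → Option E
  zero : E
  one : E
  comm : ∀ a b, padd a b = padd b a
  assoc : ∀ a b c ab abc, padd a b = some ab → padd ab c = some abc →
      ∃ bc, padd b c = some bc ∧ padd a bc = some abc
  orth_exists : ∀ a, ∃ x, padd a x = some one
  orth_unique : ∀ a x y, padd a x = some one → padd a y = some one → x = y
  add_one : ∀ a b, padd a one = some b → a = zero

namespace EffectAlgebra

variable {E : Type u} (EA : EffectAlgebra E)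

/-- `a ⊥ b` and `a ⊕ b = c`. -/
def le (a b : E) : Prop := ∃ c, EA.padd a c = some b

/-- the orthosupplement `a'`. -/
noncomputable def compl (a : E) : E := (EA.orth_exists a).choose

/-- `b ⊖ a` (the element `c` with `a ⊕ c = b`, when it exists). -/
noncomputable def osub (b a : E) : E :=
  if h : ∃ c, EA.padd a c = some b then h.choose else EA.zero

/-- the value of `a ⊕ b` (defaulting to `0` when undefined). -/
noncomputable def oplusD (a b : E) : E := (EA.padd a b).getD EA.zero

def IsSharp (a : E) : Prop := ∀ x, EA.le x a → EA.le x (EA.compl a) → x = EA.zero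

/-- sub-effect algebra. -/
def SubEA (P : Set E) : Prop :=
  EA.zero ∈ P ∧ EA.one ∈ P ∧ (∀ a ∈ P, EA.compl a ∈ P) ∧
    ∀ a ∈ P, ∀ b ∈ P, ∀ c, EA.padd a b = some c → c ∈ P

/-- Mackey compatibility: `a = a₁ ⊕ c`, `b = b₁ ⊕ c` with `a₁ ⊕ b₁ ⊕ c` defined. -/
def Mackey (a b : E) : Prop :=
  ∃ a1 b1 c d e, EA.padd a1 b1 = some d ∧ EA.padd d c = some e ∧
    EA.padd a1 c = some a ∧ EA.padd b1 c = some b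

def Additive (J : E → E) : Prop :=
  ∀ a b c, EA.padd a b = some c → EA.padd (J a) (J b) = some (J c)

def Retraction (J : E → E) : Prop :=
  EA.Additive J ∧ ∀ a, EA.le a (J EA.one) → J a = a

def Compression (J : E → E) : Prop :=
  EA.Retraction J ∧ ∀ a, (J a = EA.zero ↔ EA.le a (EA.compl (J EA.one)))

/-- `I` is a supplement of `J`: `Ker J = ran I` and `Ker I = ran J`. -/
def Supplement (I J : E → E) : Prop :=
  (∀ a, J a = EA.zero ↔ ∃ b, I b = a) ∧ (∀ a, I a = EA.zero ↔ ∃ b, J b = a)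

/-- the `n`-fold sum `n·a`, when defined. -/
def nsmulE : ℕ → E → Option E
  | 0, _ => some EA.zero
  | n + 1, a => (nsmulE n a).bind fun b => EA.padd a b

def ArchimedeanEA : Prop :=
  ∀ a : E, (∀ n : ℕ, ∃ b, EA.nsmulE n a = some b) → a = EA.zero

/-- a state on an effect algebra. -/
def IsState (s : E → ℝ) : Prop :=
  s EA.one = 1 ∧ (∀ a, 0 ≤ s a ∧ s a ≤ 1) ∧
    ∀ a b c, EA.padd a b = some c → s c = s a + s b

noncomputable def partialSum (f : ℕ → E) : ℕ → E
  | 0 => EA.zero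
  | n + 1 => EA.oplusD (partialSum f n) (f n)

/-- σ-additivity of a state: if all partial sums of an orthogonal sequence are defined
and the orthosum (= supremum of the partial sums) exists, the state is countably additive. -/
def SigmaAdditive (s : E → ℝ) : Prop :=
  ∀ f : ℕ → E, ∀ b : E,
    (∀ n, ∃ c, EA.padd (EA.partialSum f n) (f n) = some c) →
    (∀ n, EA.le (EA.partialSum f n) b) →
    (∀ c, (∀ n, EA.le (EA.partialSum f n) c) → EA.le b c) →
    Filter.Tendsto (fun n => ∑ i ∈ Finset.range n, s (f i)) Filter.atTop (nhds (s b))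

/-- A compression base: a family of compressions indexed by a sub-effect algebra `P`
such that each `p ∈ P` is the focus of `J p`, and Mackey compatible projections
compose to a projection. -/
structure CompressionBase {E : Type u} (EA : EffectAlgebra E) where
  P : Set E
  J : E → E → E
  sub : EA.SubEA P
  compr : ∀ p ∈ P, EA.Compression (J p)
  focus : ∀ p ∈ P, J p EA.one = p
  mackey : ∀ p ∈ P, ∀ q ∈ P, EA.Mackey p q → ∃ r ∈ P, J p ∘ J q = J r

variable (CB : CompressionBase EA)

/-- `a ∈ C(p)`:  `a = J_p(a) ⊕ J_{p'}(a)`. -/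
def inC (a p : E) : Prop :=
  EA.padd (CB.J p a) (CB.J (EA.compl p) a) = some a

/-- `PC(a) = {p ∈ P : a ∈ C(p)}`. -/
def PC (a : E) : Set E := {p | p ∈ CB.P ∧ inC EA CB a p}

/-- the bicommutant `P(a)`. -/
def bicomm (a : E) : Set E :=
  {p | p ∈ PC EA CB a ∧ ∀ q ∈ PC EA CB a, inC EA CB p q}

/-- `PC(A)` for a set `A ⊆ E`. -/
def PCset (A : Set E) : Set E := {p | p ∈ CB.P ∧ ∀ a ∈ A, inC EA CB a p}

/-- `P(Q) = PC(PC(Q) ∪ Q)`. -/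
def Pset (Q : Set E) : Set E := PCset EA CB (PCset EA CB Q ∪ Q)

/-- `P_≤(e,f)`. -/
def Ple (e f : E) : Set E :=
  {p | p ∈ Pset EA CB {e, f} ∧ EA.le (CB.J p e) (CB.J p f) ∧
    EA.le (CB.J (EA.compl p) f) (CB.J (EA.compl p) e)}

/-- a Boolean subalgebra of `P`: a sub-effect algebra of `E` contained in `P`
whose elements are pairwise Mackey compatible, with witnesses inside. -/
def BooleanSub (B : Set E) : Prop :=
  B ⊆ CB.P ∧ EA.SubEA B ∧
    ∀ p ∈ B, ∀ q ∈ B, ∃ p1 ∈ B, ∃ q1 ∈ B, ∃ c ∈ B, ∃ d e,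
      EA.padd p1 q1 = some d ∧ EA.padd d c = some e ∧
      EA.padd p1 c = some p ∧ EA.padd q1 c = some q

/-- `a` is a b-element with associated Boolean subalgebra `B`. -/
def IsBElementWith (a : E) (B : Set E) : Prop :=
  BooleanSub EA CB B ∧ ∀ p ∈ CB.P, (inC EA CB a p ↔ ∀ b ∈ B, inC EA CB b p)

def IsBElement (a : E) : Prop := ∃ B, IsBElementWith EA CB a B

def BProperty : Prop := ∀ a : E, IsBElement EA CB a

/-- commuting of b-elements: `e C f` iff `P(e) ↔ P(f)`. -/
def CommuteEl (e f : E) : Prop :=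
  ∀ p ∈ bicomm EA CB e, ∀ q ∈ bicomm EA CB f, EA.Mackey p q

def BComparability : Prop :=
  BProperty EA CB ∧ ∀ e f : E, CommuteEl EA CB e f → (Ple EA CB e f).Nonempty

def IsProjCover (a p : E) : Prop :=
  p ∈ CB.P ∧ ∀ q ∈ CB.P, (EA.le a q ↔ EA.le p q)

def ProjCoverProp : Prop := ∀ a : E, ∃ p, IsProjCover EA CB a p

def Spectral : Prop := ProjCoverProp EA CB ∧ BComparability EA CB

/-- a block of `P`: a maximal set of pairwise Mackey compatible projections. -/
def IsBlock (B : Set E) : Prop :=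
  B ⊆ CB.P ∧ (∀ p ∈ B, ∀ q ∈ B, EA.Mackey p q) ∧
    ∀ B' : Set E, B' ⊆ CB.P → (∀ p ∈ B', ∀ q ∈ B', EA.Mackey p q) → B ⊆ B' → B' = B

/-- the C-block `C(B)`. -/
def Cblock (B : Set E) : Set E := {a | ∀ p ∈ B, inC EA CB a p}

/-- `(f − e)_+` (the positive part, defined when `P_≤(e,f)` is nonempty). -/
noncomputable def posPart (e f : E) : E :=
  if h : (Ple EA CB e f).Nonempty then
    EA.osub (CB.J h.some f) (CB.J h.some e)
  else EA.zero

noncomputable def projCover (a : E) : E :=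
  if h : ∃ p, IsProjCover EA CB a p then h.choose else EA.zero

def IsMeetP (p q m : E) : Prop :=
  m ∈ CB.P ∧ EA.le m p ∧ EA.le m q ∧ ∀ s ∈ CB.P, EA.le s p → EA.le s q → EA.le s m

/-- `p ∧ q` in `P`. -/
noncomputable def pmeet (p q : E) : E :=
  if h : ∃ m, IsMeetP EA CB p q m then h.choose else EA.zero

/-- infimum of a set of projections in `P`. -/
def IsInfP (S : Set E) (m : E) : Prop :=
  m ∈ CB.P ∧ (∀ s ∈ S, EA.le m s) ∧
    ∀ t ∈ CB.P, (∀ s ∈ S, EA.le t s) → EA.le t m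

/-! Relative (to a projection `q`, i.e. computed in the interval `[0,q]`) notions. -/

def Pq (q : E) : Set E := {p | p ∈ CB.P ∧ EA.le p q}

def inCq (q a p : E) : Prop :=
  EA.padd (CB.J p a) (CB.J (EA.osub q p) a) = some a

def PCq (q a : E) : Set E := {p | p ∈ Pq EA CB q ∧ inCq EA CB q a p}

def bicommq (q a : E) : Set E :=
  {p | p ∈ PCq EA CB q a ∧ ∀ r ∈ PCq EA CB q a, inCq EA CB q p r}

def PCsetq (q : E) (A : Set E) : Set E :=
  {p | p ∈ Pq EA CB q ∧ ∀ a ∈ A, inCq EA CB q a p}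

def Psetq (q : E) (Q : Set E) : Set E := PCsetq EA CB q (PCsetq EA CB q Q ∪ Q)

def Pleq (q e f : E) : Set E :=
  {p | p ∈ Psetq EA CB q {e, f} ∧ EA.le (CB.J p e) (CB.J p f) ∧
    EA.le (CB.J (EA.osub q p) f) (CB.J (EA.osub q p) e)}

noncomputable def posPartq (q e f : E) : E :=
  if h : (Pleq EA CB q e f).Nonempty then
    EA.osub (CB.J h.some f) (CB.J h.some e)
  else EA.zero

def IsProjCoverq (q a p : E) : Prop :=
  p ∈ Pq EA CB q ∧ ∀ s ∈ Pq EA CB q, (EA.le a s ↔ EA.le p s)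

noncomputable def projCoverq (q a : E) : E :=
  if h : ∃ p, IsProjCoverq EA CB q a p then h.choose else EA.zero

def Mackeyq (q a b : E) : Prop :=
  ∃ a1 b1 c d e, EA.padd a1 b1 = some d ∧ EA.padd d c = some e ∧ EA.le e q ∧
    EA.padd a1 c = some a ∧ EA.padd b1 c = some b

def SubEAq (q : E) (F : Set E) : Prop :=
  EA.zero ∈ F ∧ q ∈ F ∧ (∀ x ∈ F, EA.osub q x ∈ F) ∧
    ∀ x ∈ F, ∀ y ∈ F, ∀ z, EA.padd x y = some z → EA.le z q → z ∈ F

def BooleanSubq (q : E) (B : Set E) : Prop :=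
  B ⊆ Pq EA CB q ∧ SubEAq EA q B ∧
    ∀ p ∈ B, ∀ r ∈ B, ∃ p1 ∈ B, ∃ r1 ∈ B, ∃ c ∈ B, ∃ d e,
      EA.padd p1 r1 = some d ∧ EA.padd d c = some e ∧ EA.le e q ∧
      EA.padd p1 c = some p ∧ EA.padd r1 c = some r

def IsBElementq (q a : E) : Prop :=
  ∃ B, BooleanSubq EA CB q B ∧
    ∀ p ∈ Pq EA CB q, (inCq EA CB q a p ↔ ∀ b ∈ B, inCq EA CB q b p)

def BPropertyq (q : E) : Prop := ∀ a : E, EA.le a q → IsBElementq EA CB q a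

def CommuteElq (q e f : E) : Prop :=
  ∀ p ∈ bicommq EA CB q e, ∀ r ∈ bicommq EA CB q f, Mackeyq EA q p r

def BComparabilityq (q : E) : Prop :=
  BPropertyq EA CB q ∧ ∀ e f : E, EA.le e q → EA.le f q →
    CommuteElq EA CB q e f → (Pleq EA CB q e f).Nonempty

/-! The binary spectral resolution. -/

/-- `λ(w) = Σ_j w_j 2^{-j}` (head of the list is the first digit). -/
def lamOf : List Bool → ℚ
  | [] => 0
  | b :: t => ((if b then 1 else 0) + lamOf t) / 2

/-- all binary strings of length `n`, in lexicographic order. -/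
def allStrings : ℕ → List (List Bool)
  | 0 => [[]]
  | n + 1 => (allStrings n).flatMap fun w => [w ++ [false], w ++ [true]]

noncomputable def listSum (l : List E) : E :=
  l.foldl (fun acc x => EA.oplusD acc x) EA.zero

/-- the families `(u_w, c_w)`; the binary string is given in reversed order
(head of the list is the last digit). -/
noncomputable def ucAux (a : E) : List Bool → E × E
  | [] => (projCover EA CB a, a)
  | bit :: t =>
      let p := ucAux a t
      let q := p.1
      let cw := p.2
      let cw' := EA.osub q cw
      let d := posPartq EA CB q cw' cw
      let u0 := pmeet EA CB (EA.osub q (projCoverq EA CB q d)) q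
      if bit then (pmeet EA CB q (EA.compl u0), d)
      else (u0, EA.oplusD (CB.J u0 cw) (CB.J u0 cw))

noncomputable def uw (a : E) (w : List Bool) : E := (ucAux EA CB a w.reverse).1

noncomputable def cw (a : E) (w : List Bool) : E := (ucAux EA CB a w.reverse).2

/-- the binary spectral projection `p_{a,λ(w1)}`. -/
noncomputable def pbin (a : E) (w : List Bool) : E :=
  listSum EA (EA.compl (projCover EA CB a) ::
    (((allStrings (w.length + 1)).filter
        fun v => lamOf v ≤ lamOf (w ++ [false])).map (uw EA CB a)))

def Dyadic01 (x : ℚ) : Prop := ∃ n k : ℕ, (k : ℚ) ≤ 2 ^ n ∧ x = (k : ℚ) / 2 ^ n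

/-- the binary spectral resolution `p_{a,λ}`, for dyadic rationals `λ ∈ [0,1]`. -/
noncomputable def pdyad (a : E) (x : ℚ) : E :=
  if x ≤ 0 then EA.compl (projCover EA CB a)
  else if 1 ≤ x then EA.one
  else if h : ∃ w : List Bool, lamOf (w ++ [true]) = x then pbin EA CB a h.choose
  else EA.zero

/-- the rational spectral resolution `p_{a,λ} = ⋀_{μ > λ, μ dyadic} p_{a,μ}`. -/
noncomputable def ratRes (a : E) (x : ℚ) : E :=
  if h : ∃ m, IsInfP EA CB {y | ∃ μ, Dyadic01 μ ∧ x < μ ∧ y = pdyad EA CB a μ} m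
  then h.choose else EA.zero

/-- the partial maps `f_0(b) = 2b`, `f_1(b) = (2b')'` computed in `[0,uu]`. -/
noncomputable def fstep (uu b : E) (bit : Bool) : Option E :=
  if bit then
    (if EA.le (EA.osub uu b) b
      then some (EA.osub uu (EA.oplusD (EA.osub uu b) (EA.osub uu b))) else none)
  else
    (if EA.le b (EA.osub uu b) then some (EA.oplusD b b) else none)

/-- `f_w = f_{w_n} ∘ ⋯ ∘ f_{w_1}`, computed in `[0,uu]`, as a partial map. -/
noncomputable def fword (uu : E) (w : List Bool) (b : E) : Option E :=
  w.foldl (fun ob bit => ob.bind fun x => fstep EA uu x bit) (some b)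

end EffectAlgebra

namespace EffectAlgebra

section basics

variable {E : Type u} {EA : EffectAlgebra E}

theorem compl_spec (EA : EffectAlgebra E) (a : E) : EA.padd a (EA.compl a) = some EA.one :=
  (EA.orth_exists a).choose_spec

theorem compl_eq {a b : E} (h : EA.padd a b = some EA.one) : EA.compl a = b :=
  EA.orth_unique _ _ _ (compl_spec EA a) h

theorem compl_compl (EA : EffectAlgebra E) (a : E) : EA.compl (EA.compl a) = a :=
  compl_eq (by rw [EA.comm]; exact compl_spec EA a)

theorem padd_zero (EA : EffectAlgebra E) (a : E) : EA.padd a EA.zero = some a := by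
  have h1 : EA.padd EA.one EA.zero = some EA.one := by
    obtain ⟨x, hx⟩ := EA.orth_exists EA.one
    have : x = EA.zero := EA.add_one x _ (by rw [EA.comm]; exact hx)
    rw [← this]; exact hx
  have h2 : EA.padd (EA.compl a) a = some EA.one := by
    rw [EA.comm]; exact compl_spec EA a
  obtain ⟨y, hy, hy'⟩ := EA.assoc _ _ _ _ _ h2 h1
  rw [hy, EA.orth_unique _ _ _ hy' h2]

theorem padd_cancel {a b d c : E} (h1 : EA.padd a b = some c) (h2 : EA.padd a d = some c) :
    b = d := by
  have h3 := compl_spec EA c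
  rw [EA.comm] at h1 h2
  obtain ⟨x, hx, hx'⟩ := EA.assoc _ _ _ _ _ h1 h3
  obtain ⟨y, hy, hy'⟩ := EA.assoc _ _ _ _ _ h2 h3
  rw [hx] at hy
  obtain rfl := Option.some.inj hy
  rw [EA.comm] at hx' hy'
  exact EA.orth_unique _ _ _ hx' hy'

/-- the totalisation of the partial sum: `none` is absorbing. -/
def T (_EA : EffectAlgebra E) : Type u := Option E

/-- embedding of `E` in its totalisation. -/
def i (EA : EffectAlgebra E) (a : E) : T EA := (some a : Option E)

/-- sum in the totalisation. -/
def tadd (EA : EffectAlgebra E) (x y : T EA) : T EA :=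
  Option.bind (α := E) x fun a => Option.bind (α := E) y fun b => EA.padd a b

theorem tadd_comm (x y : T EA) : tadd EA x y = tadd EA y x := by
  rcases x with _ | x <;> rcases y with _ | y
  · rfl
  · rfl
  · rfl
  · exact EA.comm x y

theorem tadd_assoc' (x y z : E) :
    tadd EA (tadd EA (i EA x) (i EA y)) (i EA z) = tadd EA (i EA x) (tadd EA (i EA y) (i EA z)) ∨
    tadd EA (tadd EA (i EA x) (i EA y)) (i EA z) = (none : Option E) := by
  change Option.bind (EA.padd x y) (fun a => EA.padd a z) =
    Option.bind (EA.padd y z) (fun a => EA.padd x a) ∨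
    Option.bind (EA.padd x y) (fun a => EA.padd a z) = none
  rcases h : EA.padd x y with _ | xy
  · right; rfl
  · rcases h' : EA.padd xy z with _ | xyz
    · right; exact h'
    · left
      obtain ⟨yz, h1, h2⟩ := EA.assoc _ _ _ _ _ h h'
      rw [h1]
      change EA.padd xy z = EA.padd x yz
      rw [h2, h']

theorem tadd_assoc (x y z : T EA) : tadd EA (tadd EA x y) z = tadd EA x (tadd EA y z) := by
  rcases x with _ | x
  · rfl
  rcases y with _ | y
  · rfl
  rcases z with _ | z
  · change Option.bind (EA.padd x y) (fun _ => none) = none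
    cases EA.padd x y <;> rfl
  rcases tadd_assoc' (EA := EA) x y z with h | h
  · exact h
  · rcases tadd_assoc' (EA := EA) z y x with h' | h'
    · rw [tadd_comm, tadd_comm (i EA z), tadd_comm _ (i EA x)] at h'
      rw [tadd_comm (i EA z)] at h'
      exact h'.symm
    · rw [tadd_comm, tadd_comm (i EA z)] at h'
      exact h.trans h'.symm

instance instTZero : Zero (T EA) := ⟨i EA EA.zero⟩

instance instTAdd : Add (T EA) := ⟨tadd EA⟩

instance instT : AddCommMonoid (T EA) where
  add_assoc := tadd_assoc
  add_comm := tadd_comm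
  zero_add x := by
    rcases x with _ | x
    · rfl
    · change EA.padd EA.zero x = some x
      rw [EA.comm]; exact padd_zero EA x
  add_zero x := by
    rcases x with _ | x
    · rfl
    · exact padd_zero EA x
  nsmul := nsmulRec

local notation "ι" => EffectAlgebra.i EA

theorem i_inj {a b : E} (h : ι a = ι b) : a = b := Option.some.inj h

theorem i_zero : ι EA.zero = 0 := rfl

theorem padd_iff {a b c : E} : EA.padd a b = some c ↔ ι a + ι b = ι c := Iff.rfl

theorem le_iff {a b : E} : EA.le a b ↔ ∃ c, ι a + ι c = ι b := Iff.rfl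

theorem def_left {x y : T EA} {c : E} (h : x + y = ι c) : ∃ a, x = ι a := by
  rcases x with _ | x
  · exact absurd h (by intro h; cases h)
  · exact ⟨x, rfl⟩

theorem def_right {x y : T EA} {c : E} (h : x + y = ι c) : ∃ a, y = ι a := by
  rw [add_comm] at h; exact def_left h

theorem t_cancel {x y z : T EA} {c : E} (h1 : x + y = ι c) (h2 : x + z = ι c) : y = z := by
  obtain ⟨a, rfl⟩ := def_left h1
  obtain ⟨b, rfl⟩ := def_right h1
  obtain ⟨d, rfl⟩ := def_right h2
  rw [padd_cancel h1 h2]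

theorem t_cancel' {x y z : T EA} {c : E} (h1 : y + x = ι c) (h2 : z + x = ι c) : y = z := by
  rw [add_comm] at h1 h2; exact t_cancel h1 h2

theorem le_of_add {a c : E} {x : T EA} (h : ι a + x = ι c) : EA.le a c := by
  obtain ⟨b, rfl⟩ := def_right h
  exact ⟨b, h⟩

theorem le_refl (a : E) : EA.le a a := ⟨EA.zero, padd_zero EA a⟩

theorem le_trans {a b c : E} (h1 : EA.le a b) (h2 : EA.le b c) : EA.le a c := by
  obtain ⟨x, hx⟩ := le_iff.1 h1
  obtain ⟨y, hy⟩ := le_iff.1 h2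
  rw [← hx, add_assoc] at hy
  exact le_of_add hy

theorem t_eq_zero {x y : T EA} (h : x + y = 0) : x = 0 := by
  have h0 : x + y = ι EA.zero := h
  obtain ⟨a, rfl⟩ := def_left h0
  have : ι a + ι EA.one = ι a + ι EA.one := rfl
  have h1 : y + (ι a + ι EA.one) = ι EA.one := by
    rw [← add_assoc, add_comm y, h, zero_add]
  obtain ⟨b, hb⟩ := def_right h1
  have := EA.add_one a b hb
  rw [this]; rfl

theorem le_antisymm {a b : E} (h1 : EA.le a b) (h2 : EA.le b a) : a = b := by
  obtain ⟨x, hx⟩ := le_iff.1 h1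
  obtain ⟨y, hy⟩ := le_iff.1 h2
  have : ι a + (ι x + ι y) = ι a := by rw [← add_assoc, hx, hy]
  have h3 : ι x + ι y = 0 := t_cancel this (add_zero _)
  have h4 := t_eq_zero h3
  rw [h4, add_zero] at hx
  exact i_inj hx

theorem zero_le (a : E) : EA.le EA.zero a := by
  refine le_of_add (x := ι a) ?_
  rw [i_zero, zero_add]

theorem compl_add (a : E) : ι a + ι (EA.compl a) = ι EA.one := compl_spec EA a

theorem le_one (a : E) : EA.le a EA.one := ⟨_, compl_add a⟩

theorem le_zero {a : E} (h : EA.le a EA.zero) : a = EA.zero := le_antisymm h (zero_le a)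

theorem osub_spec {a b : E} (h : EA.le a b) : ι a + ι (EA.osub b a) = ι b := by
  have h' : ∃ c, EA.padd a c = some b := h
  unfold osub
  rw [dif_pos h']
  exact h'.choose_spec

theorem osub_eq {a b c : E} (h : ι a + ι c = ι b) : EA.osub b a = c :=
  i_inj (t_cancel (osub_spec ⟨c, h⟩) h)

theorem osub_le {a b : E} (h : EA.le a b) : EA.le (EA.osub b a) b := by
  have := osub_spec h
  rw [add_comm] at this
  exact ⟨_, this⟩

theorem le_compl_iff {a b : E} : EA.le a (EA.compl b) ↔ ∃ c, ι a + ι b = ι c := by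
  constructor
  · rintro ⟨x, hx⟩
    have hx : ι a + ι x = ι (EA.compl b) := hx
    have := compl_add (EA := EA) b
    rw [← hx, ← add_assoc] at this
    obtain ⟨c, hc⟩ := def_left this
    exact ⟨c, by rw [add_comm, hc]⟩
  · rintro ⟨c, hc⟩
    have h := compl_add (EA := EA) c
    rw [← hc, add_assoc, add_comm, add_assoc] at h
    have h2 := t_cancel h (compl_add b)
    rw [add_comm] at h2
    exact le_of_add h2

theorem le_compl_comm {a b : E} (h : EA.le a (EA.compl b)) : EA.le b (EA.compl a) := by
  rw [le_compl_iff] at *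
  obtain ⟨c, hc⟩ := h
  exact ⟨c, by rw [add_comm, hc]⟩

theorem compl_le_compl {a b : E} (h : EA.le a b) : EA.le (EA.compl b) (EA.compl a) := by
  apply le_compl_comm; rw [compl_compl]; exact h

theorem compl_zero : EA.compl EA.zero = EA.one :=
  compl_eq (by rw [EA.comm]; exact padd_zero EA _)

theorem compl_one : EA.compl EA.one = EA.zero := compl_eq (padd_zero EA _)

theorem oplusD_spec {a b c : E} (h : ι a + ι b = ι c) : EA.oplusD a b = c := by
  unfold oplusD; rw [show EA.padd a b = some c from h]; rfl

theorem oplusD_spec' {a b c : E} (h : ι a + ι b = ι c) : ι a + ι b = ι (EA.oplusD a b) := by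
  rw [oplusD_spec h, h]

theorem nsmulE_eq (n : ℕ) (a : E) : (EA.nsmulE n a : T EA) = n • ι a := by
  induction n with
  | zero => simp only [zero_smul]; rfl
  | succ n ih =>
    rw [succ_nsmul', ← ih]
    rfl

theorem arch_pow (harch : EA.ArchimedeanEA) {m : ℕ} (hm : 0 < m) (a : E)
    (h : ∀ j : ℕ, ∃ b, (2 ^ (m * j)) • ι a = ι b) : a = EA.zero := by
  apply harch
  intro n
  obtain ⟨b, hb⟩ := h n
  have hn : n ≤ 2 ^ (m * n) := by
    calc n ≤ 2 ^ n := Nat.lt_two_pow_self.le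
      _ ≤ _ := Nat.pow_le_pow_right (by norm_num) (Nat.le_mul_of_pos_left n hm)
  obtain ⟨k, hk⟩ := Nat.exists_eq_add_of_le hn
  rw [hk, add_nsmul] at hb
  obtain ⟨c, hc⟩ := def_left hb
  exact ⟨c, (nsmulE_eq n a).trans hc⟩

end basics

end EffectAlgebra

namespace EffectAlgebra

section compr

variable {E : Type u} {EA : EffectAlgebra E} {CB : CompressionBase EA}

local notation "ι" => EffectAlgebra.i EA

theorem P_zero : EA.zero ∈ CB.P := CB.sub.1
theorem P_one : EA.one ∈ CB.P := CB.sub.2.1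
theorem P_compl {p : E} (hp : p ∈ CB.P) : EA.compl p ∈ CB.P := CB.sub.2.2.1 p hp
theorem P_add {p q r : E} (hp : p ∈ CB.P) (hq : q ∈ CB.P) (h : ι p + ι q = ι r) : r ∈ CB.P :=
  CB.sub.2.2.2 p hp q hq r h

theorem P_sub {p q r : E} (hp : p ∈ CB.P) (hr : r ∈ CB.P) (h : ι p + ι q = ι r) : q ∈ CB.P := by
  have h1 := compl_add (EA := EA) r
  rw [← h] at h1
  have h2 : (ι p + ι (EA.compl r)) + ι q = ι EA.one := by rw [← h1]; abel
  obtain ⟨s, hs⟩ := def_left h2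
  have hsP := P_add hp (P_compl hr) hs
  rw [hs] at h2
  rw [← compl_eq (EA := EA) h2]
  exact P_compl hsP

theorem P_osub {p r : E} (hp : p ∈ CB.P) (hr : r ∈ CB.P) (h : EA.le p r) : EA.osub r p ∈ CB.P :=
  P_sub hp hr (osub_spec h)

theorem J_add {p a b c : E} (hp : p ∈ CB.P) (h : ι a + ι b = ι c) :
    ι (CB.J p a) + ι (CB.J p b) = ι (CB.J p c) := (CB.compr p hp).1.1 a b c h

theorem J_mono {p a b : E} (hp : p ∈ CB.P) (h : EA.le a b) : EA.le (CB.J p a) (CB.J p b) := by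
  obtain ⟨c, hc⟩ := le_iff.1 h
  exact ⟨_, J_add hp hc⟩

theorem J_one {p : E} (hp : p ∈ CB.P) : CB.J p EA.one = p := CB.focus p hp

theorem J_le {p : E} (hp : p ∈ CB.P) (a : E) : EA.le (CB.J p a) p := by
  have := J_mono (a := a) hp (le_one a)
  rwa [J_one hp] at this

theorem J_of_le {p a : E} (hp : p ∈ CB.P) (h : EA.le a p) : CB.J p a = a :=
  (CB.compr p hp).1.2 a (by rw [CB.focus p hp]; exact h)

theorem J_zero_iff {p a : E} (hp : p ∈ CB.P) : CB.J p a = EA.zero ↔ EA.le a (EA.compl p) := by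
  have := (CB.compr p hp).2 a
  rwa [CB.focus p hp] at this

theorem J_zero_iff' {p a : E} (hp : p ∈ CB.P) : CB.J p a = EA.zero ↔ EA.le p (EA.compl a) := by
  rw [J_zero_iff hp]; exact ⟨le_compl_comm, le_compl_comm⟩

theorem J_zero {p : E} (hp : p ∈ CB.P) : CB.J p EA.zero = EA.zero := J_of_le hp (zero_le p)

theorem principal {p a b c : E} (hp : p ∈ CB.P) (ha : EA.le a p) (hb : EA.le b p)
    (h : ι a + ι b = ι c) : EA.le c p := by
  have h1 := J_add hp h
  rw [J_of_le hp ha, J_of_le hp hb, h] at h1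
  rw [i_inj h1]; exact J_le hp c

theorem sharp {p a : E} (hp : p ∈ CB.P) (h1 : EA.le a p) (h2 : EA.le a (EA.compl p)) :
    a = EA.zero := by
  rw [← J_of_le hp h1]; exact (J_zero_iff hp).2 h2

theorem inC_iff' {a p : E} : inC EA CB a p ↔ ι (CB.J p a) + ι (CB.J (EA.compl p) a) = ι a :=
  Iff.rfl

theorem inC_iff {a p : E} (hp : p ∈ CB.P) : inC EA CB a p ↔ EA.le (CB.J p a) a := by
  constructor
  · intro h; exact ⟨_, h⟩
  · intro h
    obtain ⟨x, hx⟩ := le_iff.1 h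
    have h1 := J_add hp hx
    rw [J_of_le hp (J_le hp a)] at h1
    have h2 : ι (CB.J p x) = 0 := t_cancel h1 (add_zero _)
    have h3 := (J_zero_iff hp).1 (i_inj (h2.trans i_zero.symm))
    have h4 := J_add (P_compl hp) hx
    rw [J_of_le (P_compl hp) h3] at h4
    have h5 : CB.J (EA.compl p) (CB.J p a) = EA.zero := by
      rw [J_zero_iff (P_compl hp), compl_compl]; exact J_le hp a
    rw [h5, i_zero, zero_add] at h4
    rw [inC_iff', ← h4]; exact hx

theorem inC_of_le {a p : E} (hp : p ∈ CB.P) (h : EA.le a p) : inC EA CB a p := by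
  rw [inC_iff hp, J_of_le hp h]; exact le_refl a

theorem inC_of_orth {a p : E} (hp : p ∈ CB.P) (h : EA.le a (EA.compl p)) : inC EA CB a p := by
  rw [inC_iff hp, (J_zero_iff hp).2 h]; exact zero_le a

theorem inC_compl {a p : E} (h : inC EA CB a p) : inC EA CB a (EA.compl p) := by
  rw [inC_iff'] at *
  rw [compl_compl, add_comm]; exact h

theorem inC_one {p : E} (hp : p ∈ CB.P) : inC EA CB EA.one p := by
  rw [inC_iff hp]; exact le_one _

theorem inC_add {a b c p : E} (hp : p ∈ CB.P) (ha : inC EA CB a p) (hb : inC EA CB b p)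
    (h : ι a + ι b = ι c) : inC EA CB c p := by
  rw [inC_iff'] at *
  rw [← J_add hp h, ← J_add (P_compl hp) h, ← h]
  calc _ = (ι (CB.J p a) + ι (CB.J (EA.compl p) a)) +
        (ι (CB.J p b) + ι (CB.J (EA.compl p) b)) := by abel
    _ = _ := by rw [ha, hb]

theorem inC_sub {a b c p : E} (hp : p ∈ CB.P) (ha : inC EA CB a p) (hc : inC EA CB c p)
    (h : ι a + ι b = ι c) : inC EA CB b p := by
  rw [inC_iff'] at *
  rw [← J_add hp h, ← J_add (P_compl hp) h] at hc
  have : ι a + (ι (CB.J p b) + ι (CB.J (EA.compl p) b)) = ι c := by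
    rw [← hc]; nth_rewrite 1 [← ha]; abel
  exact t_cancel this h

theorem inC_compl_left {a p : E} (hp : p ∈ CB.P) (h : inC EA CB a p) :
    inC EA CB (EA.compl a) p := inC_sub hp h (inC_one hp) (compl_add a)

theorem mackey_of_inC {p q : E} (hq : q ∈ CB.P) (h : inC EA CB p q) :
    EA.Mackey p q := by
  obtain ⟨b1, hb1⟩ := le_iff.1 (J_le hq p)
  rw [inC_iff'] at h
  have h1 := J_le (P_compl hq) p
  rw [le_compl_iff] at h1
  obtain ⟨e, he⟩ := h1
  have he' : (ι (CB.J (EA.compl q) p) + ι b1) + ι (CB.J q p) = ι e := by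
    rw [← he, ← hb1]; abel
  obtain ⟨d, hd⟩ := def_left he'
  rw [hd] at he'
  exact ⟨CB.J (EA.compl q) p, b1, CB.J q p, d, e, hd, he', by rw [padd_iff, add_comm]; exact h,
    by rw [padd_iff, add_comm]; exact hb1⟩

theorem inC_of_mackey {p q : E} (hq : q ∈ CB.P) (h : EA.Mackey p q) :
    inC EA CB p q := by
  obtain ⟨a1, b1, c, d, e, h1, h2, h3, h4⟩ := h
  rw [padd_iff] at h1 h2 h3 h4
  have h5 : EA.le a1 (EA.compl q) := by
    rw [le_compl_iff]; refine ⟨e, ?_⟩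
    rw [← h4, ← add_assoc, h1, h2]
  have h6 : EA.le c q := le_of_add (x := ι b1) (by rw [add_comm]; exact h4)
  have h7 := J_add hq h3
  rw [(J_zero_iff hq).2 h5, J_of_le hq h6, i_zero, zero_add] at h7
  rw [inC_iff hq, ← i_inj h7]
  exact le_of_add (x := ι a1) (by rw [add_comm]; exact h3)

theorem mackey_symm {p q : E} (h : EA.Mackey p q) : EA.Mackey q p := by
  obtain ⟨a1, b1, c, d, e, h1, h2, h3, h4⟩ := h
  exact ⟨b1, a1, c, d, e, by rw [EA.comm]; exact h1, h2, h4, h3⟩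

theorem inC_symm {p q : E} (hp : p ∈ CB.P) (hq : q ∈ CB.P) (h : inC EA CB p q) :
    inC EA CB q p := inC_of_mackey hp (mackey_symm (mackey_of_inC hq h))

theorem J_comp {p q : E} (hp : p ∈ CB.P) (hq : q ∈ CB.P) (h : inC EA CB p q) :
    CB.J p q ∈ CB.P ∧ ∀ x, CB.J p (CB.J q x) = CB.J (CB.J p q) x := by
  obtain ⟨r, hr, h1⟩ := CB.mackey p hp q hq (mackey_of_inC hq h)
  have h2 : CB.J p q = r := by
    have := congrFun h1 EA.one
    simp only [Function.comp] at this
    rwa [J_one hq, J_one hr] at this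
  rw [h2]
  exact ⟨hr, fun x => congrFun h1 x⟩

theorem meet_le_right {p q : E} (hp : p ∈ CB.P) (hq : q ∈ CB.P) (h : inC EA CB p q) :
    EA.le (CB.J p q) q := (inC_iff hp).1 (inC_symm hp hq h)

theorem meet_comm {p q : E} (hp : p ∈ CB.P) (hq : q ∈ CB.P) (h : inC EA CB p q) :
    CB.J p q = CB.J q p := by
  have h' := inC_symm hp hq h
  apply le_antisymm
  · have := J_mono hq (J_le hp q)
    rwa [J_of_le hq (meet_le_right hp hq h)] at this
  · have := J_mono hp (J_le hq p)
    rwa [J_of_le hp (meet_le_right hq hp h')] at this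

theorem J_J_comm {p q : E} (hp : p ∈ CB.P) (hq : q ∈ CB.P) (h : inC EA CB p q) (x : E) :
    CB.J p (CB.J q x) = CB.J q (CB.J p x) := by
  rw [(J_comp hp hq h).2, (J_comp hq hp (inC_symm hp hq h)).2, meet_comm hp hq h]

/-- `p ≤ q` implies `J_p J_q = J_p`. -/
theorem J_J_of_le {p q : E} (hp : p ∈ CB.P) (hq : q ∈ CB.P) (h : EA.le p q) (x : E) :
    CB.J p (CB.J q x) = CB.J p x := by
  have h1 := inC_of_le hq h
  rw [(J_comp hp hq h1).2, meet_comm hp hq h1, J_of_le hq h]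

theorem J_J_of_le' {p q : E} (hp : p ∈ CB.P) (hq : q ∈ CB.P) (h : EA.le p q) (x : E) :
    CB.J q (CB.J p x) = CB.J p x := J_of_le hq (le_trans (J_le hp x) h)

/-- `x ∈ C(p)`, `y` a projection in `C(p)`: `J_y x ∈ C(p)`. -/
theorem inC_J {p y x : E} (hp : p ∈ CB.P) (hy : y ∈ CB.P) (hyp : inC EA CB y p)
    (hx : inC EA CB x p) : inC EA CB (CB.J y x) p := by
  rw [inC_iff hp] at *
  rw [J_J_comm hp hy (inC_symm hy hp ((inC_iff hp).2 hyp))]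
  exact J_mono hy hx

/-- restricting a projection commuting with `q` to `q`. -/
theorem J_eq_of_le {p q x : E} (hp : p ∈ CB.P) (hq : q ∈ CB.P) (h : inC EA CB p q)
    (hx : EA.le x q) : CB.J (CB.J p q) x = CB.J p x := by
  rw [← (J_comp hp hq h).2, J_of_le hq hx]

theorem inC_meet {p q x : E} (hp : p ∈ CB.P) (hq : q ∈ CB.P) (h : inC EA CB p q)
    (h1 : inC EA CB x p) (h2 : inC EA CB x q) : inC EA CB x (CB.J p q) := by
  have hc := J_comp hp hq h
  rw [inC_iff hc.1, ← hc.2]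
  exact le_trans (J_mono hp ((inC_iff hq).1 h2)) ((inC_iff hp).1 h1)

/-- additivity of `J` in the projection. -/
theorem J_padd {p q r x : E} (hp : p ∈ CB.P) (hq : q ∈ CB.P) (h : ι p + ι q = ι r)
    (hx : inC EA CB x p) : ι (CB.J p x) + ι (CB.J q x) = ι (CB.J r x) := by
  have hr := P_add hp hq h
  have h1 := J_add hr hx
  rw [J_J_of_le' hp hr ⟨q, h⟩] at h1
  have hrp : inC EA CB p r := inC_of_le hr ⟨q, h⟩
  have hrp' := inC_compl (inC_symm hp hr hrp)
  rw [(J_comp hr (P_compl hp) hrp').2] at h1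
  have h2 : CB.J r (EA.compl p) = q := by
    have h3 := J_add hr (compl_add p)
    rw [J_of_le hr ⟨q, h⟩, J_one hr] at h3
    exact i_inj (t_cancel h3 h)
  rw [h2] at h1
  exact h1

/-- difference of projections is a meet. -/
theorem le_sub_of {p q m s : E} (hp : p ∈ CB.P) (h : ι p + ι m = ι q)
    (h1 : EA.le s q) (h2 : EA.le s (EA.compl p)) : EA.le s m := by
  have hp' := P_compl hp
  have h3 := J_mono hp' h1
  rw [J_of_le hp' h2] at h3
  have h4 := J_add hp' h
  have h5 : EA.le m (EA.compl p) := by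
    rw [le_compl_iff]; exact ⟨q, by rw [add_comm]; exact h⟩
  have h6 : CB.J (EA.compl p) p = EA.zero := by
    rw [J_zero_iff hp', compl_compl]; exact le_refl p
  rw [h6, J_of_le hp' h5, i_zero, zero_add] at h4
  rwa [i_inj h4]

theorem orth_of_add {p m q : E} (h : ι p + ι m = ι q) : EA.le p (EA.compl m) := by
  rw [le_compl_iff]; exact ⟨q, h⟩

theorem orth_of_add' {p m q : E} (h : ι p + ι m = ι q) : EA.le m (EA.compl p) :=
  le_compl_comm (orth_of_add h)

theorem le_left {p m q : E} (h : ι p + ι m = ι q) : EA.le p q := ⟨m, h⟩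

theorem le_right {p m q : E} (h : ι p + ι m = ι q) : EA.le m q := by
  rw [add_comm] at h; exact ⟨p, h⟩

theorem isMeet_unique {p q m m' : E} (h : IsMeetP EA CB p q m) (h' : IsMeetP EA CB p q m') :
    m = m' :=
  le_antisymm (h'.2.2.2 m h.1 h.2.1 h.2.2.1) (h.2.2.2 m' h'.1 h'.2.1 h'.2.2.1)

theorem pmeet_eq {p q m : E} (h : IsMeetP EA CB p q m) : pmeet EA CB p q = m := by
  have h' : ∃ m, IsMeetP EA CB p q m := ⟨m, h⟩
  unfold pmeet
  rw [dif_pos h']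
  exact isMeet_unique h'.choose_spec h

theorem pmeet_diff {p q m : E} (hp : p ∈ CB.P) (hq : q ∈ CB.P) (h : ι p + ι m = ι q) :
    pmeet EA CB q (EA.compl p) = m := by
  apply pmeet_eq
  exact ⟨P_sub hp hq h, le_right h, orth_of_add' h, fun s _ h1 h2 => le_sub_of hp h h1 h2⟩

theorem isInf_unique {S : Set E} {m m' : E} (h : IsInfP EA CB S m) (h' : IsInfP EA CB S m') :
    m = m' :=
  le_antisymm (h'.2.2 m h.1 h.2.1) (h.2.2 m' h'.1 h'.2.1)

/-- monotone sums below a complement -/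
theorem padd_le_padd {a b c d : E} {z : E} (h1 : EA.le a c) (h2 : EA.le b d)
    (h : ι c + ι d = ι z) : ∃ y, ι a + ι b = ι y ∧ EA.le y z := by
  obtain ⟨x1, hx1⟩ := le_iff.1 h1
  obtain ⟨x2, hx2⟩ := le_iff.1 h2
  rw [← hx1, ← hx2] at h
  have h' : (ι a + ι b) + (ι x1 + ι x2) = ι z := by rw [← h]; abel
  obtain ⟨y, hy⟩ := def_left h'
  rw [hy] at h'
  exact ⟨y, hy, le_of_add h'⟩

/-! projection covers -/

theorem cov_spec (hc : ProjCoverProp EA CB) (a : E) : IsProjCover EA CB a (projCover EA CB a) := by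
  unfold projCover
  rw [dif_pos (hc a)]
  exact (hc a).choose_spec

theorem cov_mem (hc : ProjCoverProp EA CB) (a : E) : projCover EA CB a ∈ CB.P :=
  (cov_spec hc a).1

theorem le_cov (hc : ProjCoverProp EA CB) (a : E) : EA.le a (projCover EA CB a) :=
  ((cov_spec hc a).2 _ (cov_mem hc a)).2 (le_refl _)

theorem cov_le (hc : ProjCoverProp EA CB) {a q : E} (hq : q ∈ CB.P) (h : EA.le a q) :
    EA.le (projCover EA CB a) q := ((cov_spec hc a).2 _ hq).1 h

theorem projCoverq_eq (hc : ProjCoverProp EA CB) {q a : E} (hq : q ∈ CB.P) (h : EA.le a q) :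
    projCoverq EA CB q a = projCover EA CB a := by
  have h' : IsProjCoverq EA CB q a (projCover EA CB a) :=
    ⟨⟨cov_mem hc a, cov_le hc hq h⟩, fun s hs => (cov_spec hc a).2 s hs.1⟩
  have h2 : ∃ p, IsProjCoverq EA CB q a p := ⟨_, h'⟩
  unfold projCoverq
  rw [dif_pos h2]
  have h3 := h2.choose_spec
  refine le_antisymm (EA := EA) ?_ ?_
  · exact (h3.2 _ h'.1).1 (le_cov hc a)
  · exact (h'.2 _ h3.1).1 ((h3.2 _ h3.1).2 (le_refl _))

theorem inC_cov (hc : ProjCoverProp EA CB) {d x : E} (hx : x ∈ CB.P) (h : inC EA CB d x) :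
    inC EA CB (projCover EA CB d) x := by
  have hx' := P_compl hx
  set k1 := projCover EA CB (CB.J x d) with hk1
  set k2 := projCover EA CB (CB.J (EA.compl x) d) with hk2
  have h1 : EA.le k1 x := cov_le hc hx (J_le hx d)
  have h2 : EA.le k2 (EA.compl x) := cov_le hc hx' (J_le hx' d)
  obtain ⟨k, hk, -⟩ := padd_le_padd h1 h2 (compl_add x)
  have hkP : k ∈ CB.P := P_add (cov_mem hc _) (cov_mem hc _) hk
  have h3 : EA.le d k := by
    obtain ⟨y, hy, hy'⟩ := padd_le_padd (le_cov hc (CB.J x d)) (le_cov hc (CB.J (EA.compl x) d)) hk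
    rw [inC_iff'.1 h] at hy
    rw [i_inj hy]; exact hy'
  have h4 := cov_le hc hkP h3
  have h5 : EA.le k (projCover EA CB d) := by
    refine principal (cov_mem hc d) ?_ ?_ hk
    · exact cov_le hc (cov_mem hc d) (le_trans (le_left h) (le_cov hc d))
    · exact cov_le hc (cov_mem hc d) (le_trans (le_right h) (le_cov hc d))
  rw [le_antisymm h4 h5]
  refine inC_add hx (inC_of_le hx h1) (inC_of_orth hx h2) hk

/-! b-elements -/

theorem inC_of_bicomm (hb : BProperty EA CB) {c q y : E} (hq : q ∈ CB.P) (hy : y ∈ CB.P)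
    (hcq : inC EA CB c q)
    (h : ∀ x ∈ CB.P, inC EA CB c x → inC EA CB x q → inC EA CB y x) : inC EA CB c y := by
  obtain ⟨B, ⟨hB1, hB2, hB3⟩, hB⟩ := hb c
  rw [hB y hy]
  intro b hbB
  have hbP := hB1 hbB
  refine inC_symm hy hbP (h b hbP ?_ ((hB q hq).1 hcq b hbB))
  rw [hB b hbP]
  intro b' hb'
  apply inC_of_mackey hbP
  obtain ⟨p1, -, q1, -, c, -, d, e, h1, h2, h3, h4⟩ := hB3 b' hb' b hbB
  exact ⟨p1, q1, c, d, e, h1, h2, h3, h4⟩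

theorem inC_of_bicomm' (hb : BProperty EA CB) {c y : E} (hy : y ∈ CB.P)
    (h : ∀ x ∈ CB.P, inC EA CB c x → inC EA CB y x) : inC EA CB c y :=
  inC_of_bicomm hb P_one hy (inC_of_le P_one (le_one c)) fun x hx hcx _ => h x hx hcx

theorem commuteEl_of {e f : E} (h : ∀ p ∈ CB.P, inC EA CB e p →
    (∀ q ∈ CB.P, inC EA CB e q → inC EA CB p q) → inC EA CB f p) : CommuteEl EA CB e f := by
  intro p hp q hq
  have hfp := h p hp.1.1 hp.1.2 (fun q hq hq' => hp.2 q ⟨hq, hq'⟩)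
  have := hq.2 p ⟨hp.1.1, hfp⟩
  exact mackey_symm (mackey_of_inC hp.1.1 this)

/-- decomposition given by an element of `P_≤(e,f)`. -/
theorem diff_of {e f p p' : E}
    (he : ι (CB.J p e) + ι (CB.J p' e) = ι e) (hf : ι (CB.J p f) + ι (CB.J p' f) = ι f)
    (h1 : EA.le (CB.J p e) (CB.J p f)) (h2 : EA.le (CB.J p' f) (CB.J p' e)) :
    ι f + ι (EA.osub (CB.J p' e) (CB.J p' f)) = ι e + ι (EA.osub (CB.J p f) (CB.J p e)) := by
  have h3 := osub_spec h1
  have h4 := osub_spec h2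
  rw [← hf, ← he, ← h4, ← h3]
  abel

end compr

end EffectAlgebra

namespace EffectAlgebra

section words

/-- numerical value of a binary word. -/
def nv : List Bool → ℕ
  | [] => 0
  | d :: t => d.toNat * 2 ^ t.length + nv t

theorem lamOf_eq (w : List Bool) : lamOf w = (nv w : ℚ) / 2 ^ w.length := by
  induction w with
  | nil => simp [lamOf, nv]
  | cons d t ih =>
    simp only [lamOf, nv, List.length_cons, ih, pow_succ]
    cases d <;> simp <;> field_simp

theorem nv_lt (w : List Bool) : nv w < 2 ^ w.length := by
  induction w with
  | nil => simp [nv]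
  | cons d t ih =>
    simp only [nv, List.length_cons, pow_succ]
    cases d <;> simp <;> omega

theorem nv_append (w v : List Bool) : nv (w ++ v) = nv w * 2 ^ v.length + nv v := by
  induction w with
  | nil => simp [nv]
  | cons d t ih =>
    simp only [nv, List.cons_append, List.length_append, ih, pow_add]
    ring

theorem nv_snoc (w : List Bool) (d : Bool) : nv (w ++ [d]) = 2 * nv w + d.toNat := by
  rw [nv_append]; simp [nv]; ring

theorem nv_inj {w v : List Bool} (hl : w.length = v.length) (h : nv w = nv v) : w = v := by
  induction w generalizing v with
  | nil => cases v with
    | nil => rfl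
    | cons => simp at hl
  | cons d t ih => cases v with
    | nil => simp at hl
    | cons d' t' =>
      simp only [List.length_cons, Nat.add_right_cancel_iff] at hl
      have h1 := nv_lt t
      have h2 := nv_lt t'
      simp only [nv, ← hl] at h h2
      cases d <;> cases d' <;> simp at h
      · rw [ih hl h]
      · omega
      · omega
      · rw [ih hl h]

theorem exists_word (n k : ℕ) (h : k < 2 ^ n) : ∃ w : List Bool, w.length = n ∧ nv w = k := by
  induction n generalizing k with
  | zero => exact ⟨[], rfl, by simp [nv]; omega⟩
  | succ n ih =>
    obtain ⟨w, hw, hk⟩ := ih (k / 2) (by rw [pow_succ] at h; omega)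
    refine ⟨w ++ [decide (k % 2 = 1)], by simp [hw], ?_⟩
    rw [nv_snoc, hk]
    by_cases h2 : k % 2 = 1
    · simp [h2]; omega
    · simp [h2]; omega

theorem lamOf_append (w v : List Bool) :
    lamOf (w ++ v) = lamOf w + (1 / 2) ^ w.length * lamOf v := by
  induction w with
  | nil => simp [lamOf]
  | cons d t ih => simp only [List.cons_append, lamOf, ih, List.length_cons, pow_succ]; ring

theorem lamOf_nonneg (w : List Bool) : 0 ≤ lamOf w := by
  rw [lamOf_eq]; positivity

theorem half_pow_eq (n : ℕ) : ((1 : ℚ) / 2) ^ n = 1 / 2 ^ n := by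
  rw [div_pow, one_pow]

theorem lamOf_succ (w : List Bool) :
    lamOf w + (1 / 2) ^ w.length = ((nv w + 1 : ℕ) : ℚ) / 2 ^ w.length := by
  rw [lamOf_eq, half_pow_eq, ← add_div]; push_cast; rfl

theorem lamOf_add_le (w : List Bool) : lamOf w + (1 / 2) ^ w.length ≤ 1 := by
  rw [lamOf_succ, div_le_one (by positivity)]
  exact_mod_cast nv_lt w

theorem lamOf_lt_one (w : List Bool) : lamOf w < 1 := by
  have h1 := lamOf_add_le w
  have h2 : (0 : ℚ) < (1 / 2) ^ w.length := by positivity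
  linarith

theorem lamOf_lt_iff {t v : List Bool} (hl : t.length = v.length) :
    lamOf t < lamOf v ↔ nv t < nv v := by
  rw [lamOf_eq, lamOf_eq, hl, div_lt_div_iff_of_pos_right (by positivity)]
  norm_cast

theorem lamOf_inj {t v : List Bool} (hl : t.length = v.length) (h : lamOf t = lamOf v) : t = v := by
  apply nv_inj hl
  have h1 := (lamOf_lt_iff hl).not.1 h.not_lt
  have h2 := (lamOf_lt_iff hl.symm).not.1 h.not_gt
  omega

theorem lamOf_gap {t v : List Bool} (hl : t.length = v.length) (h : lamOf t < lamOf v) :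
    lamOf t + (1 / 2) ^ t.length ≤ lamOf v := by
  rw [lamOf_lt_iff hl] at h
  rw [lamOf_succ, lamOf_eq, hl, div_le_div_iff_of_pos_right (by positivity)]
  exact_mod_cast h

/-- powers of a word. -/
def vpow (v : List Bool) : ℕ → List Bool
  | 0 => []
  | j + 1 => v ++ vpow v j

theorem vpow_length (v : List Bool) (j : ℕ) : (vpow v j).length = j * v.length := by
  induction j with
  | zero => simp [vpow]
  | succ j ih => simp only [vpow, List.length_append, ih]; ring

theorem split_word {Z : List Bool} {j m : ℕ} (h : Z.length = (j + 1) * m) :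
    ∃ t z, Z = t ++ z ∧ t.length = m ∧ z.length = j * m := by
  refine ⟨Z.take m, Z.drop m, (List.take_append_drop m Z).symm, ?_, ?_⟩
  · rw [List.length_take, h, add_mul]; simp
  · rw [List.length_drop, h, add_mul]; simp

end words

section rel

variable {E : Type u} {EA : EffectAlgebra E} {CB : CompressionBase EA}

local notation "ι" => EffectAlgebra.i EA

/-- relational form of the partial maps `f_0`, `f_1` in `[0,s]`. -/
def R (EA : EffectAlgebra E) (s : E) : Bool → E → E → Prop
  | false, b, x => i EA b + i EA b = i EA x ∧ EA.le x s
  | true, b, x => ∃ c, i EA b + i EA c = i EA s ∧ i EA c + i EA x = i EA b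

/-- relational form of `f_w` in `[0,s]`. -/
def FW (EA : EffectAlgebra E) (s : E) : List Bool → E → E → Prop
  | [], b, x => b = x
  | d :: t, b, x => ∃ y, R EA s d b y ∧ FW EA s t y x

theorem R_le {s b x : E} {d : Bool} (h : R EA s d b x) : EA.le x s := by
  cases d with
  | false => exact h.2
  | true =>
    obtain ⟨c, h1, h2⟩ := h
    exact le_trans (le_right h2) (le_left h1)

theorem fstep_iff {s b x : E} {d : Bool} (hb : EA.le b s) :
    fstep EA s b d = some x ↔ R EA s d b x := by
  have h0 := osub_spec hb
  cases d with
  | false =>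
    simp only [fstep, Bool.false_eq_true, if_false]
    constructor
    · intro h
      split_ifs at h with hle
      obtain ⟨y, hy⟩ := le_iff.1 hle
      rw [← hy, ← add_assoc] at h0
      obtain ⟨z, hz⟩ := def_left h0
      rw [oplusD_spec hz] at h
      obtain rfl := Option.some.inj h
      rw [hz] at h0
      exact ⟨hz, le_of_add h0⟩
    · rintro ⟨h1, h2⟩
      obtain ⟨y, hy⟩ := le_iff.1 h2
      rw [← h1, add_assoc] at hy
      have h3 := t_cancel hy h0
      rw [if_pos (le_of_add h3), oplusD_spec h1]
  | true =>
    simp only [fstep, if_true]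
    constructor
    · intro h
      split_ifs at h with hle
      obtain ⟨y, hy⟩ := le_iff.1 hle
      have h1 : (ι (EA.osub s b) + ι (EA.osub s b)) + ι y = ι s := by
        rw [← h0, add_assoc, hy, add_comm]
      obtain ⟨z, hz⟩ := def_left h1
      rw [hz] at h1
      rw [oplusD_spec hz, osub_eq h1] at h
      obtain rfl := Option.some.inj h
      exact ⟨_, h0, hy⟩
    · rintro ⟨c, h1, h2⟩
      rw [osub_eq h1, if_pos ⟨x, h2⟩]
      have h3 : (ι c + ι c) + ι x = ι s := by
        rw [← h1, ← h2]; abel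
      obtain ⟨z, hz⟩ := def_left h3
      rw [hz] at h3
      rw [oplusD_spec hz, osub_eq h3]

theorem foldl_none (s : E) (w : List Bool) :
    w.foldl (fun ob bit => ob.bind fun x => fstep EA s x bit) none = none := by
  induction w with
  | nil => rfl
  | cons d t ih => exact ih

theorem fword_cons (s b : E) (d : Bool) (t : List Bool) :
    fword EA s (d :: t) b = (fstep EA s b d).bind (fun y => fword EA s t y) := by
  unfold fword
  simp only [List.foldl_cons, Option.bind_some]
  rcases fstep EA s b d with _ | y
  · exact foldl_none s t
  · rfl

theorem fword_iff {s b x : E} {w : List Bool} (hb : EA.le b s) :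
    fword EA s w b = some x ↔ FW EA s w b x := by
  induction w generalizing b with
  | nil => simp [fword, FW]
  | cons d t ih =>
    rw [fword_cons]
    constructor
    · intro h
      rw [Option.bind_eq_some_iff] at h
      obtain ⟨y, h1, h2⟩ := h
      rw [fstep_iff hb] at h1
      exact ⟨y, h1, (ih (R_le h1)).1 h2⟩
    · rintro ⟨y, h1, h2⟩
      rw [Option.bind_eq_some_iff]
      exact ⟨y, (fstep_iff hb).2 h1, (ih (R_le h1)).2 h2⟩

theorem FW_le {s b x : E} {w : List Bool} (hb : EA.le b s) (h : FW EA s w b x) : EA.le x s := by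
  induction w generalizing b with
  | nil => rw [← show b = x from h]; exact hb
  | cons d t ih =>
    obtain ⟨y, h1, h2⟩ := h
    exact ih (R_le h1) h2

theorem FW_append {s b x : E} {w v : List Bool} :
    FW EA s (w ++ v) b x ↔ ∃ y, FW EA s w b y ∧ FW EA s v y x := by
  induction w generalizing b with
  | nil => simp [FW]
  | cons d t ih =>
    simp only [List.cons_append, FW, ih]
    constructor
    · rintro ⟨y, h1, z, h2, h3⟩; exact ⟨z, ⟨y, h1, h2⟩, h3⟩
    · rintro ⟨z, ⟨y, h1, h2⟩, h3⟩; exact ⟨y, h1, z, h2, h3⟩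

theorem R_double {s b b1 x x1 : E} {d : Bool} {δ : T EA} (h : R EA s d b x) (h1 : R EA s d b1 x1)
    (hd : ι b1 + δ = ι b) : ι x1 + 2 • δ = ι x := by
  rw [two_nsmul]
  cases d with
  | false =>
    rw [← h.1, ← h1.1, ← hd]; abel
  | true =>
    obtain ⟨c, hc1, hc2⟩ := h
    obtain ⟨c1, hd1, hd2⟩ := h1
    have h3 : ι b1 + (δ + ι c) = ι s := by rw [← hc1, ← hd]; abel
    have h4 : δ + ι c = ι c1 := t_cancel h3 hd1
    have h5 : ι c + (ι x1 + (δ + δ)) = ι b := by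
      rw [← hd, ← hd2, ← h4]; abel
    exact t_cancel h5 hc2

theorem FW_double {s b b1 x x1 : E} {w : List Bool} {δ : T EA} (h : FW EA s w b x)
    (h1 : FW EA s w b1 x1) (hd : ι b1 + δ = ι b) : ι x1 + (2 ^ w.length) • δ = ι x := by
  induction w generalizing b b1 δ with
  | nil =>
    rw [← show b = x from h, ← show b1 = x1 from h1]; simpa using hd
  | cons d t ih =>
    obtain ⟨y, h2, h3⟩ := h
    obtain ⟨y1, h4, h5⟩ := h1
    have := ih h3 h5 (R_double h2 h4 hd)
    rw [smul_smul] at this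
    rw [List.length_cons, pow_succ]; exact this

theorem FW_mono {s b b1 x x1 : E} {w : List Bool} (h : FW EA s w b x)
    (h1 : FW EA s w b1 x1) (hd : EA.le b1 b) : EA.le x1 x := by
  obtain ⟨c, hc⟩ := le_iff.1 hd
  exact le_of_add (FW_double h h1 hc)

theorem FW_det {s b x x1 : E} {w : List Bool} (h : FW EA s w b x)
    (h1 : FW EA s w b x1) : x = x1 :=
  le_antisymm (FW_mono h1 h (le_refl b)) (FW_mono h h1 (le_refl b))

theorem R_J {s r b x : E} {d : Bool} (hr : r ∈ CB.P) (hrs : EA.le r s) (h : R EA s d b x) :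
    R EA r d (CB.J r b) (CB.J r x) := by
  have hs : CB.J r s = r := by
    refine le_antisymm (J_le hr s) ?_
    have := J_mono hr hrs
    rwa [J_of_le hr (le_refl r)] at this
  cases d with
  | false => exact ⟨J_add hr h.1, J_le hr x⟩
  | true =>
    obtain ⟨c, h1, h2⟩ := h
    have h3 := J_add hr h1
    rw [hs] at h3
    exact ⟨CB.J r c, h3, J_add hr h2⟩

theorem FW_J {s r b x : E} {w : List Bool} (hr : r ∈ CB.P) (hrs : EA.le r s) (h : FW EA s w b x) :
    FW EA r w (CB.J r b) (CB.J r x) := by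
  induction w generalizing b with
  | nil => rw [show b = x from h]; rfl
  | cons d t ih =>
    obtain ⟨y, h1, h2⟩ := h
    exact ⟨_, R_J hr hrs h1, ih h2⟩

theorem R_inC {s b x p : E} {d : Bool} (hp : p ∈ CB.P) (hs : inC EA CB s p) (hb : inC EA CB b p)
    (h : R EA s d b x) : inC EA CB x p := by
  cases d with
  | false => exact inC_add hp hb hb h.1
  | true =>
    obtain ⟨c, h1, h2⟩ := h
    exact inC_sub hp (inC_sub hp hb hs h1) hb h2

theorem FW_inC {s b x p : E} {w : List Bool} (hp : p ∈ CB.P) (hs : inC EA CB s p)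
    (hb : inC EA CB b p) (h : FW EA s w b x) : inC EA CB x p := by
  induction w generalizing b with
  | nil => rw [← show b = x from h]; exact hb
  | cons d t ih =>
    obtain ⟨y, h1, h2⟩ := h
    exact ih (R_inC hp hs hb h1) h2

theorem FW_top {s y : E} {v : List Bool} (h : FW EA s v s y) :
    s = EA.zero ∨ (lamOf v + (1 / 2) ^ v.length = 1 ∧ y = s) := by
  induction v with
  | nil => right; exact ⟨by simp [lamOf], (show s = y from h).symm⟩
  | cons d t ih =>
    obtain ⟨z, h1, h2⟩ := h
    cases d with
    | false =>
      left
      obtain ⟨h3, h4⟩ := h1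
      obtain ⟨e, he⟩ := le_iff.1 h4
      rw [← h3, add_assoc] at he
      have := t_eq_zero (t_cancel he (add_zero _))
      exact i_inj this
    | true =>
      obtain ⟨c, h3, h4⟩ := h1
      have h5 : ι c = 0 := t_cancel h3 (add_zero _)
      rw [h5, zero_add] at h4
      rw [i_inj h4] at h2
      rcases ih h2 with h6 | ⟨h6, h7⟩
      · left; exact h6
      · right
        refine ⟨?_, h7⟩
        simp only [lamOf, List.length_cons, pow_succ, if_true]; linarith

theorem FW_bot {s x : E} {v : List Bool} (h : FW EA s v EA.zero x) :
    s = EA.zero ∨ (lamOf v = 0 ∧ x = EA.zero) := by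
  induction v with
  | nil => right; exact ⟨by simp [lamOf], (show EA.zero = x from h).symm⟩
  | cons d t ih =>
    obtain ⟨z, h1, h2⟩ := h
    cases d with
    | true =>
      left
      obtain ⟨c, h3, h4⟩ := h1
      rw [i_zero] at h3 h4
      rw [t_eq_zero h4, zero_add] at h3
      exact (i_inj h3).symm
    | false =>
      have h3 := h1.1
      rw [i_zero, zero_add] at h3
      rw [← i_inj (i_zero.trans h3)] at h2
      rcases ih h2 with h6 | ⟨h6, h7⟩
      · left; exact h6
      · right
        refine ⟨?_, h7⟩
        simp [lamOf, h6]

/-- comparison lemma. -/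
theorem FW_compare {s x y x' y' : E} {t v : List Bool} (hl : t.length = v.length)
    (hxy : EA.le x y) (hx : FW EA s t x x') (hy : FW EA s v y y')
    (hlt : lamOf v < lamOf t) :
    s = EA.zero ∨ (lamOf t = lamOf v + (1 / 2) ^ v.length ∧ y' = s ∧ x' = EA.zero) := by
  induction t generalizing v x y with
  | nil =>
    cases v with
    | nil => exact absurd hlt (lt_irrefl _)
    | cons => simp at hl
  | cons d t ih =>
    cases v with
    | nil => simp at hl
    | cons d' v =>
      simp only [List.length_cons, Nat.add_right_cancel_iff] at hl
      have b1 := lamOf_nonneg t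
      have b2 := lamOf_nonneg v
      have b3 := lamOf_lt_one t
      have b4 := lamOf_lt_one v
      have same : d = d' → s = EA.zero ∨ (lamOf (d :: t) = lamOf (d' :: v) +
          (1 / 2) ^ (d' :: v).length ∧ y' = s ∧ x' = EA.zero) := by
        rintro rfl
        obtain ⟨x1, h1, h2⟩ := hx
        obtain ⟨y1, h3, h4⟩ := hy
        have h5 : EA.le x1 y1 := by
          obtain ⟨c, hc⟩ := le_iff.1 hxy
          exact le_of_add (R_double h3 h1 hc)
        have h6 : lamOf v < lamOf t := by
          simp only [lamOf] at hlt; linarith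
        rcases ih hl h5 h2 h4 h6 with h | ⟨h, h'⟩
        · left; exact h
        · right; refine ⟨?_, h'⟩
          simp only [lamOf, List.length_cons, pow_succ, h]; ring
      cases d <;> cases d'
      · exact same rfl
      · exfalso
        simp [lamOf] at hlt
        linarith
      · obtain ⟨x1, ⟨c, h1, h2⟩, h3⟩ := hx
        obtain ⟨y1, ⟨h4, h5⟩, h6⟩ := hy
        obtain ⟨δ, hδ⟩ := le_iff.1 hxy
        obtain ⟨e, he⟩ := le_iff.1 h5
        have h7 : ι x + (ι x + (ι δ + ι δ) + ι e) = ι s := by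
          rw [← he, ← h4, ← hδ]; abel
        have h8 : ι x + (ι δ + ι δ) + ι e = ι c := t_cancel h7 h1
        have h9 : ι c + (ι x1 + (ι δ + ι δ) + ι e) = ι c := by
          nth_rewrite 2 [← h8]; rw [← h2]; abel
        have h10 : ι x1 + (ι δ + ι δ) + ι e = 0 := t_cancel h9 (add_zero _)
        have h11 : ι e = 0 := by
          rw [add_comm] at h10; exact t_eq_zero h10
        have h12 : ι x1 = 0 := by
          rw [add_assoc] at h10; exact t_eq_zero h10
        rw [h11, add_zero] at he
        rw [i_inj he] at h6
        rw [i_inj (h12.trans i_zero.symm)] at h3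
        rcases FW_top h6 with h | ⟨g1, g2⟩
        · left; exact h
        rcases FW_bot h3 with h | ⟨g3, g4⟩
        · left; exact h
        right
        refine ⟨?_, g2, g4⟩
        simp only [lamOf, List.length_cons, pow_succ, if_true, g3]
        simp only [Bool.false_eq_true, if_false]
        linarith
      · exact same rfl

/-- if `f_v(e) = g ≤ e` then `e` is at most the periodic number `.vvv…`. -/
theorem FW_below {s e g x : E} {v Z : List Bool} {l0 : ℚ} {j : ℕ} (hv : 0 < v.length)
    (hl0 : l0 = lamOf v + (1 / 2) ^ v.length * l0) (h0 : 0 ≤ l0) (h1 : l0 < 1)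
    (hes : EA.le e s) (heg : FW EA s v e g) (hge : EA.le g e) (hZ : Z.length = j * v.length)
    (hx : FW EA s Z g x) (hlt : l0 < lamOf Z) : s = EA.zero := by
  induction j generalizing e g Z with
  | zero =>
    have : Z = [] := by
      apply List.length_eq_zero_iff.1; simpa using hZ
    subst this
    simp [lamOf] at hlt; linarith
  | succ j ih =>
    obtain ⟨t, z, rfl, ht, hz⟩ := split_word hZ
    rw [FW_append] at hx
    obtain ⟨y, hy1, hy2⟩ := hx
    have hpow : (0 : ℚ) < (1 / 2) ^ v.length := by positivity
    have hpow1 : ((1 : ℚ) / 2) ^ v.length < 1 := pow_lt_one₀ (by norm_num) (by norm_num) hv.ne'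
    rw [lamOf_append, ht] at hlt
    rcases lt_trichotomy (lamOf t) (lamOf v) with h | h | h
    · have := lamOf_gap ht h
      rw [ht] at this
      have hz1 := lamOf_lt_one z
      exfalso
      nlinarith
    · have := lamOf_inj ht h
      subst this
      refine ih (FW_le hes heg) hy1 (FW_mono heg hy1 hge) hz hy2 ?_
      rw [hl0] at hlt
      have : (1 / 2) ^ t.length * l0 < (1 / 2) ^ t.length * lamOf z := by linarith
      exact lt_of_mul_lt_mul_left this hpow.le
    · rcases FW_compare ht hge hy1 heg h with h2 | ⟨h2, h3, h4⟩
      · exact h2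
      · subst h3
        have : e = g := le_antisymm hes hge
        subst this
        rcases FW_top heg with h5 | ⟨h5, -⟩
        · exact h5
        · exfalso
          have : (1 - (1 / 2) ^ v.length) * (1 - l0) = 0 := by linarith
          rcases mul_eq_zero.1 this with h6 | h6 <;> linarith

/-- if `f_v(e) = g ≥ e` and `g` lies strictly below `v^j`, then `g = e`. -/
theorem FW_above {s e g x : E} {v Z : List Bool} {j : ℕ}
    (hes : EA.le e s) (heg : FW EA s v e g) (hge : EA.le e g) (hZ : Z.length = j * v.length)
    (hx : FW EA s Z g x) (hlt : lamOf Z < lamOf (vpow v j)) : g = e := by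
  induction j generalizing e g Z with
  | zero =>
    simp only [vpow] at hlt
    have := lamOf_nonneg Z
    simp [lamOf] at hlt; linarith
  | succ j ih =>
    obtain ⟨t, z, rfl, ht, hz⟩ := split_word hZ
    rw [FW_append] at hx
    obtain ⟨y, hy1, hy2⟩ := hx
    have hpow : (0 : ℚ) < (1 / 2) ^ v.length := by positivity
    simp only [vpow] at hlt
    rw [lamOf_append, lamOf_append, ht] at hlt
    have hgs := FW_le hes heg
    rcases lt_trichotomy (lamOf t) (lamOf v) with h | h | h
    · rcases FW_compare ht.symm hge heg hy1 h with h2 | ⟨h2, h3, h4⟩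
      · rw [h2] at hgs hes
        rw [le_zero hgs, le_zero hes]
      · rw [h4] at hge
        rw [h4, le_zero hge]
    · have := lamOf_inj ht h
      subst this
      have h2 : lamOf z < lamOf (vpow t j) := by
        have : (1 / 2) ^ t.length * lamOf z < (1 / 2) ^ t.length * lamOf (vpow t j) := by linarith
        exact lt_of_mul_lt_mul_left this hpow.le
      have h3 := ih hgs hy1 (FW_mono hy1 heg hge) hz hy2 h2
      obtain ⟨δ, hδ⟩ := le_iff.1 hge
      have h4 := FW_double hy1 heg hδ
      rw [h3] at h4
      have h5 := t_cancel h4 (add_zero _)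
      obtain ⟨k, hk⟩ := Nat.exists_eq_add_of_le (Nat.one_le_two_pow (n := t.length))
      rw [hk, add_nsmul, one_nsmul] at h5
      rw [t_eq_zero h5, add_zero] at hδ
      exact (i_inj hδ).symm
    · have h2 := lamOf_gap ht.symm h
      have := lamOf_lt_one (vpow v j)
      have := lamOf_nonneg z
      exfalso
      nlinarith

/-- multiples of `f_v(e) ⊖ e`. -/
theorem FW_multiple {s e g x : E} {v : List Bool} {j : ℕ} {δ : T EA} (heg : FW EA s v e g)
    (hd : ι e + δ = ι g) (hx : FW EA s (vpow v j) g x) :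
    ∃ b, (2 ^ (v.length * j)) • δ = ι b := by
  induction j generalizing e g δ with
  | zero => simpa using def_right hd
  | succ j ih =>
    simp only [vpow] at hx
    rw [FW_append] at hx
    obtain ⟨y, hy1, hy2⟩ := hx
    have h1 := FW_double hy1 heg hd
    obtain ⟨b, hb⟩ := ih hy1 h1 hy2
    rw [smul_smul, ← pow_add] at hb
    exact ⟨b, by rw [← hb]; congr 2⟩

end rel

end EffectAlgebra

namespace EffectAlgebra

section binres

variable {E : Type u} {EA : EffectAlgebra E} {CB : CompressionBase EA}

local notation "ι" => EffectAlgebra.i EA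

theorem inCq_iff {p0 q x : E} (hp0 : p0 ∈ CB.P) (hq : q ∈ CB.P) (h : inC EA CB q p0)
    (hx : EA.le x q) : inCq EA CB q x (CB.J p0 q) ↔ inC EA CB x p0 := by
  have h1 : EA.osub q (CB.J p0 q) = CB.J (EA.compl p0) q := osub_eq h
  have hs := inC_symm hq hp0 h
  have hs' := inC_compl_left hq hs
  unfold inCq
  rw [h1, J_eq_of_le hp0 hq hs hx, J_eq_of_le (P_compl hp0) hq hs' hx]
  rfl

theorem Pleq_nonempty (hspec : Spectral EA CB) {q c c' : E} (hq : q ∈ CB.P)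
    (h : ι c + ι c' = ι q) : (Pleq EA CB q c' c).Nonempty := by
  have hcq := le_left h
  have hcq' := le_right h
  have h' : ι c' + ι c = ι q := by rw [add_comm]; exact h
  have hcomm : CommuteEl EA CB c' c := by
    apply commuteEl_of
    intro p hp hcp hall
    have h1 := inC_symm hp hq (hall q hq (inC_of_le hq hcq'))
    exact inC_sub hp hcp h1 h'
  obtain ⟨p0, ⟨hp0, hall⟩, h1, h2⟩ := hspec.2.2 c' c hcomm
  have hqp : inC EA CB q p0 := by
    apply hall; left
    refine ⟨hq, ?_⟩
    rintro x (rfl | rfl)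
    · exact inC_of_le hq hcq'
    · exact inC_of_le hq hcq
  have hs := inC_symm hq hp0 hqp
  have hs' := inC_compl_left hq hs
  refine ⟨CB.J p0 q, ⟨⟨(J_comp hp0 hq hs).1, meet_le_right hp0 hq hs⟩, ?_⟩, ?_, ?_⟩
  · intro x hx
    rcases hx with hx | hx
    · rw [inCq_iff hp0 hq hqp hx.1.2]
      apply hall; left
      refine ⟨hx.1.1, ?_⟩
      intro y hy
      rw [inC_iff hx.1.1]
      exact ⟨_, hx.2 y hy⟩
    · have hxq : EA.le x q := by
        rcases hx with rfl | rfl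
        · exact hcq'
        · exact hcq
      rw [inCq_iff hp0 hq hqp hxq]
      apply hall; right; exact hx
  · rw [J_eq_of_le hp0 hq hs hcq, J_eq_of_le hp0 hq hs hcq']; exact h1
  · have h3 : EA.osub q (CB.J p0 q) = CB.J (EA.compl p0) q := osub_eq hqp
    rw [h3, J_eq_of_le (P_compl hp0) hq hs' hcq, J_eq_of_le (P_compl hp0) hq hs' hcq']; exact h2

theorem posPartq_spec (hspec : Spectral EA CB) {q c c' : E} (hq : q ∈ CB.P)
    (h : ι c + ι c' = ι q) : ∃ p z, p ∈ CB.P ∧ ι c + ι z = ι c' + ι (posPartq EA CB q c' c) ∧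
      EA.le (posPartq EA CB q c' c) p ∧ EA.le z (EA.compl p) ∧
      EA.le (posPartq EA CB q c' c) c ∧
      ∀ x ∈ CB.P, inC EA CB c x → inC EA CB q x → inC EA CB (posPartq EA CB q c' c) x := by
  have hcq := le_left h
  have hcq' := le_right h
  have hne := Pleq_nonempty hspec hq h
  unfold posPartq
  rw [dif_pos hne]
  have hsome : hne.some ∈ Pleq EA CB q c' c := hne.some_mem
  set p := hne.some with hp
  clear_value p
  obtain ⟨⟨⟨hpP, hpq⟩, hall⟩, h1, h2⟩ := hsome
  have hc : ι (CB.J p c) + ι (CB.J (EA.osub q p) c) = ι c := hall c (by right; right; rfl)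
  have hc' : ι (CB.J p c') + ι (CB.J (EA.osub q p) c') = ι c' := hall c' (by right; left; rfl)
  have hqs := osub_spec hpq
  have hQ : EA.osub q p ∈ CB.P := P_osub hpP hq hpq
  have hd1 := osub_spec h1
  refine ⟨p, _, hpP, diff_of hc' hc h1 h2, ?_, ?_, ?_, ?_⟩
  · exact le_trans (le_right hd1) (J_le hpP c)
  · refine le_trans (le_trans (le_right (osub_spec h2)) (J_le hQ c')) (orth_of_add' hqs)
  · exact le_trans (le_right hd1) (le_left hc)
  · intro x hx hcx hqx
    have hcx' := inC_sub hx hcx hqx h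
    have hxq := inC_symm hq hx hqx
    have hx1 := (J_comp hx hq hxq).1
    have hx1q := meet_le_right hx hq hxq
    have h3 : inCq EA CB q (CB.J x q) p := by
      apply hall; left
      refine ⟨⟨hx1, hx1q⟩, ?_⟩
      rintro y (rfl | rfl)
      · rw [inCq_iff hx hq hqx hcq']; exact hcx'
      · rw [inCq_iff hx hq hqx hcq]; exact hcx
    have h4 : inC EA CB (CB.J x q) p := by
      rw [inC_iff hpP]; exact ⟨_, h3⟩
    have h5 := inC_symm hx1 hpP h4
    have h6 : inC EA CB p x := by
      rw [inC_iff hx1, J_eq_of_le hx hq hxq hpq] at h5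
      rw [inC_iff hx]; exact h5
    exact inC_sub hx (inC_J hx hpP h6 hcx') (inC_J hx hpP h6 hcx) hd1

theorem uc_step (hspec : Spectral EA CB) (a : E) (t : List Bool) {q c u0 u1 c0 c1 : E}
    (hqc : ucAux EA CB a t = (q, c)) (h0 : ucAux EA CB a (false :: t) = (u0, c0))
    (h1 : ucAux EA CB a (true :: t) = (u1, c1)) (hq : q ∈ CB.P) (hc : EA.le c q) :
    u0 ∈ CB.P ∧ u1 ∈ CB.P ∧ ι u0 + ι u1 = ι q ∧ R EA u0 false (CB.J u0 c) c0 ∧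
    R EA u1 true (CB.J u1 c) c1 ∧ projCover EA CB c1 = u1 ∧
    ∀ x ∈ CB.P, inC EA CB c x → inC EA CB q x →
      inC EA CB u0 x ∧ inC EA CB u1 x ∧ inC EA CB c0 x ∧ inC EA CB c1 x := by
  have hcc := osub_spec hc
  obtain ⟨p, z, hp, hz1, hz2, hz3, hz4, hz5⟩ := posPartq_spec hspec hq hcc
  simp only [ucAux, hqc, if_true, Bool.false_eq_true, if_false] at h0 h1
  set c' := EA.osub q c with hc'
  set d := posPartq EA CB q c' c with hd
  have hdq : EA.le d q := le_trans hz4 hc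
  rw [projCoverq_eq hspec.1 hq hdq] at h0 h1
  set k := projCover EA CB d with hk
  have hkP : k ∈ CB.P := cov_mem hspec.1 d
  have hkq : EA.le k q := cov_le hspec.1 hq hdq
  have hkp : EA.le k p := cov_le hspec.1 hp hz2
  have hdk : EA.le d k := le_cov hspec.1 d
  have hU := osub_spec hkq
  have hUP : EA.osub q k ∈ CB.P := P_osub hkP hq hkq
  have hm0 : pmeet EA CB (EA.osub q k) q = EA.osub q k :=
    pmeet_eq ⟨hUP, le_refl _, le_right hU, fun s _ hs _ => hs⟩
  rw [hm0] at h0 h1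
  have hU' : ι (EA.osub q k) + ι k = ι q := by rw [add_comm]; exact hU
  rw [pmeet_diff hUP hq hU'] at h1
  obtain ⟨rfl, rfl⟩ := Prod.mk.inj h1
  obtain ⟨rfl, rfl⟩ := Prod.mk.inj h0
  set u := EA.osub q k with hu
  have huq : EA.le u q := le_right hU
  have hJq : ∀ r ∈ CB.P, EA.le r q → ι (CB.J r c) + ι (CB.J r c') = ι r := by
    intro r hr hrq
    rw [J_add hr hcc]
    congr 1
    refine le_antisymm (J_le hr q) ?_
    have := J_mono hr hrq
    rwa [J_of_le hr (le_refl r)] at this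
  have e1 : ι (CB.J k c') + ι d = ι (CB.J k c) := by
    have hzk : EA.le z (EA.compl k) := le_trans hz3 (compl_le_compl hkp)
    have hs := le_iff.1 (le_right (EA := EA) (p := c) (m := c') hcc)
    obtain ⟨y, hy⟩ : ∃ y, ι c + ι z = ι y := by
      have : EA.le c' (EA.compl c) := orth_of_add' hcc
      have hpc := hz4
      obtain ⟨y, hy, -⟩ := padd_le_padd (EA := EA) (le_refl c') hz4
        (by rw [add_comm]; exact hcc : ι c' + ι c = ι q)
      exact ⟨y, by rw [hz1, hy]⟩
    have g1 := J_add hkP hy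
    rw [hz1] at hy
    have g2 := J_add hkP hy
    rw [(J_zero_iff hkP).2 hzk, i_zero, add_zero] at g1
    rw [J_of_le hkP hdk] at g2
    rw [g1, g2]
  have e0 : ι (CB.J u c) + ι (CB.J u z) = ι (CB.J u c') := by
    obtain ⟨y, hy, -⟩ := padd_le_padd (EA := EA) (le_refl c') hz4
      (by rw [add_comm]; exact hcc : ι c' + ι c = ι q)
    have g2 := J_add hUP hy
    rw [← hz1] at hy
    have g1 := J_add hUP hy
    have hdu : EA.le d (EA.compl u) := le_trans hdk (orth_of_add hU)
    rw [(J_zero_iff hUP).2 hdu, i_zero, add_zero] at g2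
    rw [g1, g2]
  have e2 : (ι (CB.J u c) + ι (CB.J u c)) + ι (CB.J u z) = ι u := by
    rw [add_assoc, e0, hJq u hUP huq]
  obtain ⟨cc, hcc2⟩ := def_left e2
  have hcc3 := oplusD_spec hcc2
  rw [hcc3]
  refine ⟨hUP, hkP, hU', ⟨hcc2, ?_⟩, ⟨CB.J k c', hJq k hkP hkq, e1⟩, rfl, ?_⟩
  · rw [hcc2] at e2; exact le_left e2
  · intro x hx hcx hqx
    have hdx := hz5 x hx hcx hqx
    have hkx := inC_cov hspec.1 hx hdx
    have hux := inC_sub hx hkx hqx hU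
    have := inC_J hx hUP hux hcx
    exact ⟨hux, hkx, inC_add hx this this hcc2, hdx⟩

/-- the collected invariants of the binary resolution. -/
structure UInv (CB : CompressionBase EA) (a : E) (w : List Bool) : Prop where
  mem : uw EA CB a w ∈ CB.P
  le : EA.le (cw EA CB a w) (uw EA CB a w)
  fw : FW EA (uw EA CB a w) w (CB.J (uw EA CB a w) a) (cw EA CB a w)
  comm : ∀ x ∈ CB.P, inC EA CB a x →
    inC EA CB (uw EA CB a w) x ∧ inC EA CB (cw EA CB a w) x

theorem uw_step (hspec : Spectral EA CB) (a : E) (w : List Bool) (h : UInv CB a w) :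
    UInv CB a (w ++ [false]) ∧ UInv CB a (w ++ [true]) ∧
    ι (uw EA CB a (w ++ [false])) + ι (uw EA CB a (w ++ [true])) = ι (uw EA CB a w) ∧
    projCover EA CB (cw EA CB a (w ++ [true])) = uw EA CB a (w ++ [true]) := by
  have e : ∀ d, ucAux EA CB a (d :: w.reverse) =
      (uw EA CB a (w ++ [d]), cw EA CB a (w ++ [d])) := by
    intro d; simp [uw, cw]
  have e' : ucAux EA CB a w.reverse = (uw EA CB a w, cw EA CB a w) := rfl
  obtain ⟨h1, h2, h3, h4, h5, h6, h7⟩ := uc_step hspec a w.reverse e' (e false) (e true) h.mem h.le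
  have key : ∀ d u', u' ∈ CB.P → EA.le u' (uw EA CB a w) →
      R EA u' d (CB.J u' (cw EA CB a w)) (cw EA CB a (w ++ [d])) →
      FW EA u' (w ++ [d]) (CB.J u' a) (cw EA CB a (w ++ [d])) := by
    intro d u' hu' hle hR
    rw [FW_append]
    have := FW_J hu' hle h.fw
    rw [J_J_of_le hu' h.mem hle] at this
    exact ⟨_, this, _, hR, rfl⟩
  refine ⟨⟨h1, R_le h4, key _ _ h1 (le_left h3) h4, ?_⟩, ⟨h2, R_le h5, key _ _ h2 (le_right h3) h5, ?_⟩,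
    h3, h6⟩
  · intro x hx hax
    have := h7 x hx (h.comm x hx hax).2 (h.comm x hx hax).1
    exact ⟨this.1, this.2.2.1⟩
  · intro x hx hax
    have := h7 x hx (h.comm x hx hax).2 (h.comm x hx hax).1
    exact ⟨this.2.1, this.2.2.2⟩

theorem uw_nil (a : E) : uw EA CB a [] = projCover EA CB a := rfl
theorem cw_nil (a : E) : cw EA CB a [] = a := rfl

theorem uInv (hspec : Spectral EA CB) (a : E) (w : List Bool) : UInv CB a w := by
  induction w using List.reverseRecOn with
  | nil =>
    refine ⟨cov_mem hspec.1 a, le_cov hspec.1 a, ?_, ?_⟩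
    · exact J_of_le (cov_mem hspec.1 a) (le_cov hspec.1 a)
    · intro x hx hax
      exact ⟨inC_cov hspec.1 hx hax, hax⟩
  | append_singleton w d ih =>
    have := uw_step hspec a w ih
    cases d
    · exact this.1
    · exact this.2.1

theorem uw_mem (hspec : Spectral EA CB) (a : E) (w : List Bool) : uw EA CB a w ∈ CB.P :=
  (uInv hspec a w).mem

theorem uw_comm (hspec : Spectral EA CB) (a : E) (w : List Bool) {x : E} (hx : x ∈ CB.P)
    (h : inC EA CB a x) : inC EA CB (uw EA CB a w) x := ((uInv hspec a w).comm x hx h).1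

theorem uw_inC (hspec : Spectral EA CB) (a : E) (w : List Bool) : inC EA CB a (uw EA CB a w) :=
  inC_of_bicomm' hspec.2.1 (uw_mem hspec a w) fun _ hx h => uw_comm hspec a w hx h

theorem uw_split (hspec : Spectral EA CB) (a : E) (w : List Bool) :
    ι (uw EA CB a (w ++ [false])) + ι (uw EA CB a (w ++ [true])) = ι (uw EA CB a w) :=
  (uw_step hspec a w (uInv hspec a w)).2.2.1

theorem uw_snoc_le (hspec : Spectral EA CB) (a : E) (w : List Bool) (d : Bool) :
    EA.le (uw EA CB a (w ++ [d])) (uw EA CB a w) := by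
  cases d
  · exact le_left (uw_split hspec a w)
  · exact le_right (uw_split hspec a w)

theorem uw_append_le (hspec : Spectral EA CB) (a : E) (w v : List Bool) :
    EA.le (uw EA CB a (w ++ v)) (uw EA CB a w) := by
  induction v using List.reverseRecOn with
  | nil => rw [List.append_nil]; exact le_refl _
  | append_singleton v d ih =>
    rw [← List.append_assoc]
    exact le_trans (uw_snoc_le hspec a (w ++ v) d) ih

theorem uw_orth (hspec : Spectral EA CB) (a : E) {w v : List Bool} (hl : w.length = v.length)
    (hne : w ≠ v) : EA.le (uw EA CB a w) (EA.compl (uw EA CB a v)) := by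
  induction w using List.reverseRecOn generalizing v with
  | nil =>
    exfalso; apply hne
    exact (List.length_eq_zero_iff.1 hl.symm).symm
  | append_singleton w d ih =>
    rcases List.eq_nil_or_concat v with rfl | ⟨v, d', rfl⟩
    · simp at hl
    · simp only [List.concat_eq_append] at hl hne ⊢
      simp only [List.length_append, List.length_cons, List.length_nil,
        Nat.add_right_cancel_iff] at hl
      by_cases hwv : w = v
      · subst hwv
        have hd : d ≠ d' := fun h => hne (by rw [h])
        have hs := uw_split hspec a w
        cases d <;> cases d'
        · exact absurd rfl hd
        · exact orth_of_add hs
        · exact orth_of_add' hs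
        · exact absurd rfl hd
      · exact le_trans (uw_snoc_le hspec a w d)
          (le_trans (ih hl hwv) (compl_le_compl (uw_snoc_le hspec a v d')))

end binres

end EffectAlgebra


namespace EffectAlgebra

section dyad

variable {E : Type u} {EA : EffectAlgebra E} {CB : CompressionBase EA}
local notation "ι" => EffectAlgebra.i EA

structure Bp (CB : CompressionBase EA) (a : E) (n k : ℕ) (p : E) : Prop where
  mem : p ∈ CB.P
  comm : ∀ x ∈ CB.P, inC EA CB a x → inC EA CB p x
  base : EA.le (EA.compl (projCover EA CB a)) p
  lo : ∀ v : List Bool, v.length = n → nv v < k → EA.le (uw EA CB a v) p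
  hi : ∀ v : List Bool, v.length = n → k ≤ nv v → EA.le (uw EA CB a v) (EA.compl p)

theorem Bp.inC (hspec : Spectral EA CB) {a : E} {n k : ℕ} {p : E} (h : Bp CB a n k p) :
    EffectAlgebra.inC EA CB a p := inC_of_bicomm' hspec.2.1 h.mem h.comm

theorem Bp_up (hspec : Spectral EA CB) {a : E} {n k : ℕ} {p : E} :
    Bp CB a n k p ↔ Bp CB a (n + 1) (2 * k) p := by
  constructor
  · intro h
    refine ⟨h.mem, h.comm, h.base, ?_, ?_⟩
    · intro v hv hk
      rcases List.eq_nil_or_concat v with rfl | ⟨v, d, rfl⟩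
      · simp at hv
      · simp only [List.concat_eq_append, nv_snoc] at hv hk ⊢
        refine le_trans (uw_snoc_le hspec a v d) (h.lo v (by simpa using hv) (by omega))
    · intro v hv hk
      rcases List.eq_nil_or_concat v with rfl | ⟨v, d, rfl⟩
      · simp at hv
      · simp only [List.concat_eq_append, nv_snoc] at hv hk ⊢
        refine le_trans (uw_snoc_le hspec a v d) (h.hi v (by simpa using hv) ?_)
        cases d <;> simp at hk <;> omega
  · intro h
    refine ⟨h.mem, h.comm, h.base, ?_, ?_⟩
    · intro v hv hk
      refine principal h.mem (h.lo _ ?_ ?_) (h.lo _ ?_ ?_) (uw_split hspec a v)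
      · simp [hv]
      · rw [nv_snoc]; simp; omega
      · simp [hv]
      · rw [nv_snoc]; simp; omega
    · intro v hv hk
      refine principal (P_compl h.mem) (h.hi _ ?_ ?_) (h.hi _ ?_ ?_) (uw_split hspec a v)
      · simp [hv]
      · rw [nv_snoc]; simp; omega
      · simp [hv]
      · rw [nv_snoc]; simp; omega

theorem Bp_shift (hspec : Spectral EA CB) {a : E} {n k : ℕ} {p : E} (j : ℕ) :
    Bp CB a n k p ↔ Bp CB a (n + j) (2 ^ j * k) p := by
  induction j with
  | zero => simp
  | succ j ih =>
    rw [ih, Bp_up hspec]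
    have : 2 * (2 ^ j * k) = 2 ^ (j + 1) * k := by ring
    rw [this, add_assoc]

theorem Bp_transfer (hspec : Spectral EA CB) {a : E} {n k m l : ℕ} {p : E}
    (h : Bp CB a n k p) (he : (k : ℚ) / 2 ^ n = (l : ℚ) / 2 ^ m) : Bp CB a m l p := by
  rw [Bp_shift hspec n]
  have h1 := (Bp_shift hspec m).1 h
  rw [div_eq_div_iff (by positivity) (by positivity)] at he
  have : 2 ^ n * l = 2 ^ m * k := by
    have : ((2 ^ n * l : ℕ) : ℚ) = ((2 ^ m * k : ℕ) : ℚ) := by push_cast; linarith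
    exact_mod_cast this
  rw [this, add_comm]; exact h1

theorem uw_tot (hspec : Spectral EA CB) {a : E} (n : ℕ) {h : E} (hh : h ∈ CB.P)
    (h0 : EA.le (EA.compl (projCover EA CB a)) h)
    (h1 : ∀ v : List Bool, v.length = n → EA.le (uw EA CB a v) h) : h = EA.one := by
  induction n with
  | zero =>
    apply le_antisymm (le_one h)
    exact principal hh (h1 [] rfl) h0 (compl_add (projCover EA CB a))
  | succ n ih =>
    apply ih
    intro v hv
    exact principal hh (h1 _ (by simp [hv])) (h1 _ (by simp [hv])) (uw_split hspec a v)

theorem Bp_mono (hspec : Spectral EA CB) {a : E} {n k l : ℕ} {p q : E}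
    (hp : Bp CB a n k p) (hq : Bp CB a n l q) (hkl : k ≤ l) : EA.le p q := by
  have hc : inC EA CB p (EA.compl q) := inC_compl (hp.comm q hq.mem (hq.inC hspec))
  have hq' := P_compl hq.mem
  have hm := (J_comp hp.mem hq' hc).1
  have m1 := J_le hp.mem (EA.compl q)
  have m2 := meet_le_right hp.mem hq' hc
  have m3 : EA.le q (EA.compl (CB.J p (EA.compl q))) := le_compl_comm m2
  have h1 : EA.compl (CB.J p (EA.compl q)) = EA.one := by
    apply uw_tot hspec (a := a) n (P_compl hm)
    · exact le_trans hq.base m3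
    · intro v hv
      by_cases hk : nv v < k
      · exact le_trans (hq.lo v hv (by omega)) m3
      · exact le_trans (hp.hi v hv (by omega)) (compl_le_compl m1)
  have h2 : CB.J p (EA.compl q) = EA.zero := by
    rw [← compl_compl EA (CB.J p (EA.compl q)), h1, compl_one]
  have h3 := (J_zero_iff' hp.mem).1 h2
  rwa [compl_compl] at h3

theorem Bp_unique (hspec : Spectral EA CB) {a : E} {n k : ℕ} {p q : E}
    (hp : Bp CB a n k p) (hq : Bp CB a n k q) : p = q :=
  le_antisymm (Bp_mono hspec hp hq (Nat.le_refl k)) (Bp_mono hspec hq hp (Nat.le_refl k))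

theorem foldl_spec (l : List E) : ∀ acc : E, acc ∈ CB.P → (∀ x ∈ l, x ∈ CB.P) →
    (∀ x ∈ l, EA.le acc (EA.compl x)) → l.Pairwise (fun x y => EA.le x (EA.compl y)) →
    let r := l.foldl (fun acc x => EA.oplusD acc x) acc
    r ∈ CB.P ∧ EA.le acc r ∧ (∀ x ∈ l, EA.le x r) ∧
    (∀ z ∈ CB.P, EA.le acc z → (∀ x ∈ l, EA.le x z) → EA.le r z) ∧
    (∀ y ∈ CB.P, inC EA CB acc y → (∀ x ∈ l, inC EA CB x y) → inC EA CB r y) := by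
  induction l with
  | nil =>
    intro acc h1 _ _ _
    exact ⟨h1, le_refl acc, by simp, fun z _ h _ => h, fun y _ h _ => h⟩
  | cons x l ih =>
    intro acc h1 h2 h3 h4
    obtain ⟨c, hc⟩ := le_compl_iff.1 (h3 x (by simp))
    have hx := h2 x (by simp)
    rw [List.pairwise_cons] at h4
    have := ih c (P_add h1 hx hc) (fun y hy => h2 y (by simp [hy]))
      (fun y hy => principal (P_compl (h2 y (by simp [hy]))) (h3 y (by simp [hy])) (h4.1 y hy) hc)
      h4.2
    simp only [List.foldl_cons, oplusD_spec hc]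
    obtain ⟨t1, t2, t3, t4, t5⟩ := this
    refine ⟨t1, le_trans (le_left hc) t2, ?_, ?_, ?_⟩
    · intro y hy
      rcases List.mem_cons.1 hy with rfl | hy
      · exact le_trans (le_right hc) t2
      · exact t3 y hy
    · intro z hz hz1 hz2
      exact t4 z hz (principal hz hz1 (hz2 x (by simp)) hc) (fun y hy => hz2 y (by simp [hy]))
    · intro z hz hz1 hz2
      exact t5 z hz (inC_add hz hz1 (hz2 x (by simp)) hc) (fun y hy => hz2 y (by simp [hy]))

theorem mem_allStrings {n : ℕ} {v : List Bool} : v ∈ allStrings n ↔ v.length = n := by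
  induction n generalizing v with
  | zero => simp [allStrings, List.length_eq_zero_iff]
  | succ n ih =>
    simp only [allStrings, List.mem_flatMap, ih]
    constructor
    · rintro ⟨w, hw, hv⟩
      simp only [List.mem_cons, List.not_mem_nil, or_false] at hv
      rcases hv with rfl | rfl <;> simp [hw]
    · intro hv
      rcases List.eq_nil_or_concat v with rfl | ⟨v, d, rfl⟩
      · simp at hv
      · refine ⟨v, by simpa using hv, ?_⟩
        cases d <;> simp

theorem nodup_allStrings (n : ℕ) : (allStrings n).Nodup := by
  induction n with
  | zero => simp [allStrings]
  | succ n ih =>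
    simp only [allStrings]
    rw [List.nodup_flatMap]
    refine ⟨fun x _ => by simp, ?_⟩
    refine List.Pairwise.imp ?_ ih
    intro x y hxy
    simp only [Function.onFun]
    intro z h1 h2
    simp only [List.mem_cons, List.not_mem_nil, or_false] at h1 h2
    apply hxy
    rcases h1 with rfl | rfl <;> rcases h2 with h2 | h2 <;> simp at h2 <;> exact h2

theorem pbin_Bp (hspec : Spectral EA CB) (a : E) (w : List Bool) :
    Bp CB a (w.length + 1) (2 * nv w + 1) (pbin EA CB a w) := by
  have hcov := cov_mem hspec.1 a
  set L := (allStrings (w.length + 1)).filter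
        (fun v => lamOf v ≤ lamOf (w ++ [false])) with hL
  have hmem : ∀ v, v ∈ L ↔ v.length = w.length + 1 ∧ nv v < 2 * nv w + 1 := by
    intro v
    rw [hL, List.mem_filter, mem_allStrings]
    refine and_congr_right fun hv => ?_
    rw [decide_eq_true_eq, ← not_lt, lamOf_lt_iff (by simp [hv]), nv_snoc]
    simp
  have h1 := foldl_spec (CB := CB) (EA.compl (projCover EA CB a) :: L.map (uw EA CB a)) EA.zero P_zero
    (by
      intro x hx
      rcases List.mem_cons.1 hx with rfl | hx
      · exact P_compl hcov
      · obtain ⟨v, _, rfl⟩ := List.mem_map.1 hx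
        exact uw_mem hspec a v)
    (fun x _ => zero_le _)
    (by
      rw [List.pairwise_cons]
      constructor
      · intro x hx
        obtain ⟨v, _, rfl⟩ := List.mem_map.1 hx
        exact compl_le_compl (uw_append_le hspec a [] v)
      · rw [List.pairwise_map]
        have hnd : L.Nodup := (nodup_allStrings _).filter _
        refine List.Pairwise.imp_of_mem ?_ hnd
        intro x y hx hy hxy
        exact uw_orth hspec a (((hmem x).1 hx).1.trans ((hmem y).1 hy).1.symm) hxy)
  obtain ⟨t1, -, t3, t4, t5⟩ := h1
  refine ⟨t1, ?_, t3 _ (by simp), ?_, ?_⟩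
  · intro x hx hax
    refine t5 x hx (inC_of_le hx (zero_le x)) ?_
    intro y hy
    rcases List.mem_cons.1 hy with rfl | hy
    · exact inC_compl_left hx (inC_cov hspec.1 hx hax)
    · obtain ⟨v, _, rfl⟩ := List.mem_map.1 hy
      exact uw_comm hspec a v hx hax
  · intro v hv hk
    exact t3 _ (List.mem_cons_of_mem _ (List.mem_map_of_mem ((hmem v).2 ⟨hv, hk⟩)))
  · intro v hv hk
    apply le_compl_comm
    refine t4 _ (P_compl (uw_mem hspec a v)) (zero_le _) ?_
    intro y hy
    rcases List.mem_cons.1 hy with rfl | hy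
    · exact compl_le_compl (uw_append_le hspec a [] v)
    · obtain ⟨v', hv', rfl⟩ := List.mem_map.1 hy
      have := (hmem v').1 hv'
      refine uw_orth hspec a (this.1.trans hv.symm) ?_
      rintro rfl
      omega

theorem exists_snoc_true (n k : ℕ) (h0 : 0 < k) (h1 : k < 2 ^ n) :
    ∃ w : List Bool, lamOf (w ++ [true]) = (k : ℚ) / 2 ^ n := by
  induction n generalizing k with
  | zero => simp at h1; omega
  | succ n ih =>
    rcases Nat.even_or_odd' k with ⟨c, rfl | rfl⟩
    · obtain ⟨w, hw⟩ := ih c (by omega) (by rw [pow_succ] at h1; omega)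
      refine ⟨w, hw.trans ?_⟩
      rw [pow_succ]; push_cast; field_simp
    · obtain ⟨w, hw, hc⟩ := exists_word n c (by rw [pow_succ] at h1; omega)
      refine ⟨w, ?_⟩
      rw [lamOf_eq, nv_snoc, hc]
      simp [hw]

theorem pdyad_Bp (hspec : Spectral EA CB) (a : E) (n k : ℕ) (hk : k ≤ 2 ^ n) :
    Bp CB a n k (pdyad EA CB a ((k : ℚ) / 2 ^ n)) := by
  have hcov := cov_mem hspec.1 a
  unfold pdyad
  by_cases h0 : k = 0
  · subst h0
    rw [if_pos (by simp)]
    refine ⟨P_compl hcov, fun x hx hax => inC_compl_left hx (inC_cov hspec.1 hx hax), le_refl _, ?_, ?_⟩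
    · intro v _ h; omega
    · intro v _ _; rw [compl_compl]; exact uw_append_le hspec a [] v
  · have hk0 : (0 : ℚ) < k := by exact_mod_cast Nat.pos_of_ne_zero h0
    rw [if_neg (by rw [not_le]; positivity)]
    by_cases h1 : k = 2 ^ n
    · subst h1
      rw [if_pos (by push_cast; rw [div_self (by positivity)])]
      refine ⟨P_one, fun x hx _ => inC_one hx, le_one _, fun v _ _ => le_one _, ?_⟩
      intro v hv h
      have := nv_lt v
      rw [hv] at this; omega
    · have hk1 : k < 2 ^ n := by omega
      have hk1' : (k : ℚ) < 2 ^ n := by exact_mod_cast hk1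
      rw [if_neg (by rw [not_le, div_lt_one (by positivity)]; exact hk1')]
      have hex := exists_snoc_true n k (by omega) hk1
      rw [dif_pos hex]
      have hs := hex.choose_spec
      rw [lamOf_eq, nv_snoc] at hs
      refine Bp_transfer hspec (pbin_Bp hspec a hex.choose) ?_
      refine Eq.trans ?_ hs
      simp

theorem pd_mem (hspec : Spectral EA CB) (a : E) {x : ℚ} (hx : Dyadic01 x) :
    pdyad EA CB a x ∈ CB.P := by
  obtain ⟨n, k, h, rfl⟩ := hx
  exact (pdyad_Bp hspec a n k (by exact_mod_cast h)).mem

theorem pd_comm (hspec : Spectral EA CB) (a : E) {x : ℚ} (hx : Dyadic01 x) {y : E} (hy : y ∈ CB.P)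
    (h : inC EA CB a y) : inC EA CB (pdyad EA CB a x) y := by
  obtain ⟨n, k, h1, rfl⟩ := hx
  exact (pdyad_Bp hspec a n k (by exact_mod_cast h1)).comm y hy h

theorem pd_inC (hspec : Spectral EA CB) (a : E) {x : ℚ} (hx : Dyadic01 x) :
    inC EA CB a (pdyad EA CB a x) :=
  inC_of_bicomm' hspec.2.1 (pd_mem hspec a hx) fun _ hy h => pd_comm hspec a hx hy h

theorem dy_common {x y : ℚ} (hx : Dyadic01 x) (hy : Dyadic01 y) :
    ∃ n k l : ℕ, k ≤ 2 ^ n ∧ l ≤ 2 ^ n ∧ x = (k : ℚ) / 2 ^ n ∧ y = (l : ℚ) / 2 ^ n := by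
  obtain ⟨n, k, h, rfl⟩ := hx
  obtain ⟨m, l, h', rfl⟩ := hy
  have h1 : k ≤ 2 ^ n := by exact_mod_cast h
  have h2 : l ≤ 2 ^ m := by exact_mod_cast h'
  refine ⟨n + m, k * 2 ^ m, l * 2 ^ n, ?_, ?_, ?_, ?_⟩
  · rw [pow_add]; exact Nat.mul_le_mul_right _ h1
  · rw [pow_add, mul_comm]; exact Nat.mul_le_mul_left _ h2
  · push_cast; rw [pow_add]; field_simp
  · push_cast; rw [pow_add]; field_simp

theorem pd_mono (hspec : Spectral EA CB) (a : E) {x y : ℚ} (hx : Dyadic01 x) (hy : Dyadic01 y)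
    (h : x ≤ y) : EA.le (pdyad EA CB a x) (pdyad EA CB a y) := by
  obtain ⟨n, k, l, hk, hl, rfl, rfl⟩ := dy_common hx hy
  refine Bp_mono hspec (pdyad_Bp hspec a n k hk) (pdyad_Bp hspec a n l hl) ?_
  rw [div_le_div_iff_of_pos_right (by positivity)] at h
  exact_mod_cast h

theorem pd_zero (a : E) : pdyad EA CB a 0 = EA.compl (projCover EA CB a) := by
  unfold pdyad; rw [if_pos (_root_.le_refl _)]

theorem pd_one (a : E) : pdyad EA CB a 1 = EA.one := by
  unfold pdyad; rw [if_neg (by norm_num), if_pos (_root_.le_refl _)]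

theorem dy_lam (w : List Bool) : Dyadic01 (lamOf w) :=
  ⟨w.length, nv w, by exact_mod_cast (nv_lt w).le, lamOf_eq w⟩

theorem dy_lam' (w : List Bool) : Dyadic01 (lamOf w + (1 / 2) ^ w.length) :=
  ⟨w.length, nv w + 1, by exact_mod_cast (nv_lt w), lamOf_succ w⟩

theorem dy_zero : Dyadic01 0 := ⟨0, 0, by norm_num, by norm_num⟩
theorem dy_one : Dyadic01 1 := ⟨0, 1, by norm_num, by norm_num⟩

theorem dy_le_one {x : ℚ} (h : Dyadic01 x) : x ≤ 1 := by
  obtain ⟨n, k, h, rfl⟩ := h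
  rw [div_le_one (by positivity)]; exact h

theorem dy_nonneg {x : ℚ} (h : Dyadic01 x) : 0 ≤ x := by
  obtain ⟨n, k, h, rfl⟩ := h
  positivity

theorem pd_add (hspec : Spectral EA CB) (a : E) (v : List Bool) :
    ι (pdyad EA CB a (lamOf v)) + ι (uw EA CB a v) =
      ι (pdyad EA CB a (lamOf v + (1 / 2) ^ v.length)) := by
  have h1 := pdyad_Bp hspec a v.length (nv v) (nv_lt v).le
  have h2 := pdyad_Bp hspec a v.length (nv v + 1) (nv_lt v)
  rw [← lamOf_eq] at h1
  rw [← lamOf_succ] at h2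
  obtain ⟨c, hc⟩ := le_compl_iff.1 (le_compl_comm (h1.hi v rfl (Nat.le_refl _)))
  rw [hc]
  congr 1
  have hu := uw_mem hspec a v
  refine Bp_unique hspec (n := v.length) (k := nv v + 1) ⟨P_add h1.mem hu hc, ?_, ?_, ?_, ?_⟩ h2
  · intro x hx hax
    exact inC_add hx (h1.comm x hx hax) (uw_comm hspec a v hx hax) hc
  · exact le_trans h1.base (le_left hc)
  · intro t ht hk
    by_cases h : nv t < nv v
    · exact le_trans (h1.lo t ht h) (le_left hc)
    · rw [nv_inj ht (by omega : nv t = nv v)]; exact le_right hc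
  · intro t ht hk
    apply le_compl_comm
    refine principal (P_compl (uw_mem hspec a t)) (le_compl_comm (h1.hi t ht (by omega))) ?_ hc
    refine uw_orth hspec a ht.symm ?_
    rintro rfl; omega

/-- If `x` is a projection orthogonal to all `u_Z` with `lam Z ≥ mu`, then `x ≤ p_mu`. -/
theorem le_pd (hspec : Spectral EA CB) (a : E) {n k : ℕ} (hk : k ≤ 2 ^ n) {x : E}
    (h : ∀ Z : List Bool, Z.length = n → k ≤ nv Z → EA.le x (EA.compl (uw EA CB a Z))) :
    EA.le x (pdyad EA CB a ((k : ℚ) / 2 ^ n)) := by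
  obtain ⟨d, hd⟩ : ∃ d, k + d = 2 ^ n := ⟨2 ^ n - k, by omega⟩
  induction d generalizing k with
  | zero =>
    have : k = 2 ^ n := by omega
    subst this
    push_cast
    rw [div_self (by positivity), pd_one]; exact le_one x
  | succ d ih =>
    have h1 := ih (k := k + 1) (by omega) (fun Z h1 h2 => h Z h1 (by omega)) (by omega)
    obtain ⟨v, hv, hkv⟩ := exists_word n k (by omega)
    subst hv; subst hkv
    rw [← lamOf_succ] at h1
    rw [← lamOf_eq]
    have h2 := pd_add hspec a v
    rw [add_comm] at h2
    exact le_sub_of (uw_mem hspec a v) h2 h1 (h v rfl (Nat.le_refl _))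

/-- If `x` is a projection orthogonal to `(a°)'` and all `u_Z` with `lam Z < mu`,
then `x` is orthogonal to `p_mu`. -/
theorem orth_pd (hspec : Spectral EA CB) (a : E) {n k : ℕ} (hk : k ≤ 2 ^ n) {x : E}
    (hx : x ∈ CB.P) (h0 : EA.le x (projCover EA CB a))
    (h : ∀ Z : List Bool, Z.length = n → nv Z < k → EA.le x (EA.compl (uw EA CB a Z))) :
    EA.le (pdyad EA CB a ((k : ℚ) / 2 ^ n)) (EA.compl x) := by
  induction k with
  | zero =>
    simp only [Nat.cast_zero, zero_div]
    rw [pd_zero]; exact compl_le_compl h0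
  | succ k ih =>
    have h1 := ih (by omega) (fun Z h1 h2 => h Z h1 (by omega))
    obtain ⟨v, hv, hkv⟩ := exists_word n k (by omega)
    subst hv; subst hkv
    rw [← lamOf_eq] at h1
    rw [← lamOf_succ]
    exact principal (P_compl hx) h1 (le_compl_comm (h v rfl (by omega))) (pd_add hspec a v)

end dyad

end EffectAlgebra


namespace EffectAlgebra

section interleave

variable {E : Type u} {EA : EffectAlgebra E} {CB : CompressionBase EA}
local notation "ι" => EffectAlgebra.i EA

structure Lev (CB : CompressionBase EA) (a : E) (n : ℕ) (G : ℕ → E) : Prop where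
  mem : ∀ k, k ≤ 2 ^ n → G k ∈ CB.P
  zero : EA.le (G 0) (EA.compl a)
  one : G (2 ^ n) = EA.one
  step : ∀ v : List Bool, v.length = n → ∃ u ∈ CB.P, i EA (G (nv v)) + i EA u = i EA (G (nv v + 1)) ∧
    ∃ x, FW EA u v (CB.J u a) x

theorem FW_restrict {u r a x : E} {v : List Bool} (hu : u ∈ CB.P) (hr : r ∈ CB.P)
    (hru : EA.le r u) (h : FW EA u v (CB.J u a) x) : FW EA r v (CB.J r a) (CB.J r x) := by
  have := FW_J hr hru h
  rwa [J_J_of_le hr hu hru] at this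

theorem lev_orth {u t a x y : E} {v w : List Bool} (hl : v.length = w.length) (hu : u ∈ CB.P)
    (ht : t ∈ CB.P) (hc : inC EA CB u t) (h1 : FW EA u v (CB.J u a) x)
    (h2 : FW EA t w (CB.J t a) y) (hlt : nv v + 1 < nv w) : EA.le u (EA.compl t) := by
  have hr := (J_comp hu ht hc).1
  have hru := J_le hu t
  have hrt := meet_le_right hu ht hc
  have h3 := FW_restrict hu hr hru h1
  have h4 := FW_restrict ht hr hrt h2
  rcases FW_compare hl.symm (le_refl _) h4 h3 ((lamOf_lt_iff hl).2 (by omega)) with h | ⟨h, -⟩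
  · exact (J_zero_iff' hu).1 h
  · exfalso
    rw [lamOf_succ, lamOf_eq, hl, div_left_inj' (by positivity)] at h
    have : nv w = nv v + 1 := by exact_mod_cast h
    omega

theorem lev_orth0 {u t a y : E} {w : List Bool} (hu : u ∈ CB.P)
    (ht : t ∈ CB.P) (hc : inC EA CB u t) (h1 : EA.le u (EA.compl a))
    (h2 : FW EA t w (CB.J t a) y) (hlt : 0 < nv w) : EA.le u (EA.compl t) := by
  have hr := (J_comp hu ht hc).1
  have hru := J_le hu t
  have hrt := meet_le_right hu ht hc
  have h4 := FW_restrict ht hr hrt h2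
  rw [(J_zero_iff' hr).2 (le_trans hru h1)] at h4
  rcases FW_bot h4 with h | ⟨h, -⟩
  · exact (J_zero_iff' hu).1 h
  · exfalso
    rw [lamOf_eq, div_eq_zero_iff] at h
    rcases h with h | h
    · have : nv w = 0 := by exact_mod_cast h
      omega
    · exact absurd h (by positivity)

theorem lev_le {a : E} {n : ℕ} {G H : ℕ → E} (hG : Lev CB a n G) (hH : Lev CB a n H)
    (hc : ∀ k l, k ≤ 2 ^ n → l ≤ 2 ^ n → inC EA CB (G k) (H l)) {k l : ℕ} (hkl : k < l)
    (hl : l ≤ 2 ^ n) : EA.le (G k) (H l) := by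
  have key : ∀ (w : List Bool), w.length = n → ∀ t ∈ CB.P, ι (H (nv w)) + ι t = ι (H (nv w + 1)) →
      (∃ y, FW EA t w (CB.J t a) y) → ∀ k, k < nv w → EA.le (G k) (EA.compl t) := by
    intro w hw t ht hadd ⟨y, hy⟩ k hk
    have hwlt := nv_lt w
    rw [hw] at hwlt
    have hGt : ∀ k, k ≤ 2 ^ n → inC EA CB (G k) t := by
      intro k hk
      refine inC_symm ht (hG.mem k hk) ?_
      refine inC_sub (hG.mem k hk) ?_ ?_ hadd
      · exact inC_symm (hG.mem k hk) (hH.mem _ (by omega)) (hc k _ hk (by omega))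
      · exact inC_symm (hG.mem k hk) (hH.mem _ (by omega)) (hc k _ hk (by omega))
    induction k with
    | zero => exact lev_orth0 (hG.mem 0 (by omega)) ht (hGt 0 (by omega)) hG.zero hy hk
    | succ k ih =>
      obtain ⟨v, hv, hvk⟩ := exists_word n k (by omega)
      obtain ⟨u, hu, hu1, x, hx⟩ := hG.step v hv
      rw [hvk] at hu1
      refine principal (P_compl ht) (ih (by omega)) ?_ hu1
      refine lev_orth (hv.trans hw.symm) hu ht ?_ hx hy (by omega)
      exact inC_sub ht (hGt _ (by omega)) (hGt _ (by omega)) hu1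
  obtain ⟨d, hd⟩ : ∃ d, l + d = 2 ^ n := ⟨2 ^ n - l, by omega⟩
  induction d generalizing l with
  | zero =>
    rw [show l = 2 ^ n by omega, hH.one]; exact le_one _
  | succ d ih =>
    have h1 := ih (l := l + 1) (by omega) (by omega) (by omega)
    obtain ⟨v, hv, hvk⟩ := exists_word n l (by omega)
    obtain ⟨u, hu, hu1, hx⟩ := hH.step v hv
    have h2 := key v hv u hu hu1 hx k (by omega)
    rw [hvk, add_comm] at hu1
    exact le_sub_of hu hu1 h1 h2

theorem lev_pd (hspec : Spectral EA CB) (a : E) (n : ℕ) :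
    Lev CB a n (fun k => pdyad EA CB a ((k : ℚ) / 2 ^ n)) := by
  refine ⟨fun k hk => (pdyad_Bp hspec a n k hk).mem, ?_, ?_, ?_⟩
  · simp only [Nat.cast_zero, zero_div]
    rw [pd_zero]; exact compl_le_compl (le_cov hspec.1 a)
  · push_cast
    rw [div_self (by positivity), pd_one]
  · intro v hv
    subst hv
    refine ⟨_, uw_mem hspec a v, ?_, _, (uInv hspec a v).fw⟩
    rw [← lamOf_eq, ← lamOf_succ]
    exact pd_add hspec a v

theorem exists_dyadic {x y : ℚ} (h0 : 0 ≤ x) (hxy : x < y) (hy : y ≤ 1) :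
    ∃ μ, Dyadic01 μ ∧ x < μ ∧ μ < y := by
  obtain ⟨n, hn⟩ := exists_pow_lt_of_lt_one (sub_pos.2 hxy) (by norm_num : (1 / 2 : ℚ) < 1)
  rw [half_pow_eq] at hn
  have hp : (0 : ℚ) < 2 ^ n := by positivity
  have hf := Nat.lt_floor_add_one (x * 2 ^ n)
  have hf2 := Nat.floor_le (by positivity : 0 ≤ x * 2 ^ n)
  have h1 : x < ((⌊x * 2 ^ n⌋₊ + 1 : ℕ) : ℚ) / 2 ^ n := by
    rw [lt_div_iff₀ hp]; push_cast; exact hf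
  have h2 : ((⌊x * 2 ^ n⌋₊ + 1 : ℕ) : ℚ) / 2 ^ n < y := by
    have : ((⌊x * 2 ^ n⌋₊ + 1 : ℕ) : ℚ) / 2 ^ n ≤ x + 1 / 2 ^ n := by
      push_cast
      rw [add_div]
      gcongr
      rw [div_le_iff₀ hp]; exact hf2
    linarith
  refine ⟨_, ⟨n, ⌊x * 2 ^ n⌋₊ + 1, ?_, rfl⟩, h1, h2⟩
  have := h2.le.trans hy
  rwa [div_le_one hp] at this

def Fam (EA : EffectAlgebra E) (CB : CompressionBase EA) (a : E) (f : ℚ → E) : Prop :=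
  (∀ lam : ℚ, 0 ≤ lam → lam ≤ 1 → f lam ∈ PC EA CB a) ∧
      (EA.le (f 0) (EA.compl a) ∧ f 1 = EA.one ∧
        ∀ lam mu : ℚ, 0 ≤ lam → lam ≤ mu → mu ≤ 1 → EA.le (f lam) (f mu)) ∧
      (∀ lam : ℚ, 0 ≤ lam → lam ≤ 1 →
        IsInfP EA CB {y | ∃ μ : ℚ, lam < μ ∧ μ ≤ 1 ∧ y = f μ} (f lam)) ∧
      (∀ w : List Bool,
        ∃ b : E, fword EA
          (pmeet EA CB (f (lamOf w + (1 / 2) ^ w.length)) (EA.compl (f (lamOf w)))) w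
          (CB.J (pmeet EA CB (f (lamOf w + (1 / 2) ^ w.length))
            (EA.compl (f (lamOf w)))) a) = some b)

theorem ratRes_eq {a : E} {x : ℚ} {m : E}
    (h : IsInfP EA CB {y | ∃ μ, Dyadic01 μ ∧ x < μ ∧ y = pdyad EA CB a μ} m) :
    ratRes EA CB a x = m := by
  have hex : ∃ m, IsInfP EA CB {y | ∃ μ, Dyadic01 μ ∧ x < μ ∧ y = pdyad EA CB a μ} m := ⟨m, h⟩
  unfold ratRes
  rw [dif_pos hex]
  exact isInf_unique hex.choose_spec h

theorem lev_fam {a : E} {f : ℚ → E} (hf : Fam EA CB a f) (n : ℕ) :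
    Lev CB a n (fun k => f ((k : ℚ) / 2 ^ n)) := by
  obtain ⟨h1, ⟨h2, h3, h4⟩, -, h6⟩ := hf
  refine ⟨?_, ?_, ?_, ?_⟩
  · intro k hk
    refine (h1 _ (by positivity) ?_).1
    rw [div_le_one (by positivity)]; exact_mod_cast hk
  · simpa using h2
  · push_cast
    rw [div_self (by positivity), h3]
  · intro v hv
    subst hv
    have l0 := lamOf_nonneg v
    have l1 := lamOf_add_le v
    have l2 : (0 : ℚ) < (1 / 2) ^ v.length := by positivity
    have m1 := (h1 (lamOf v) l0 (by linarith)).1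
    have m2 := (h1 (lamOf v + (1 / 2) ^ v.length) (by linarith) l1).1
    have hle := h4 (lamOf v) (lamOf v + (1 / 2) ^ v.length) l0 (by linarith) l1
    have hs := osub_spec hle
    obtain ⟨b, hb⟩ := h6 v
    rw [pmeet_diff m1 m2 hs] at hb
    have hu := P_sub m1 m2 hs
    refine ⟨_, hu, ?_, b, (fword_iff (J_le hu a)).1 hb⟩
    rw [← lamOf_eq, ← lamOf_succ]
    exact hs

theorem fam_unique (hspec : Spectral EA CB) {a : E} {f : ℚ → E} (hf : Fam EA CB a f) {lam : ℚ}
    (h0 : 0 ≤ lam) (h1 : lam ≤ 1) : f lam = ratRes EA CB a lam := by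
  have hfm : ∀ {n k : ℕ}, k ≤ 2 ^ n → f ((k : ℚ) / 2 ^ n) ∈ PC EA CB a := by
    intro n k hk
    refine (hf.1 _ (by positivity) ?_)
    rw [div_le_one (by positivity)]; exact_mod_cast hk
  have hc : ∀ n k l : ℕ, k ≤ 2 ^ n → l ≤ 2 ^ n →
      inC EA CB (pdyad EA CB a ((k : ℚ) / 2 ^ n)) (f ((l : ℚ) / 2 ^ n)) := fun n k l hk hl =>
    (pdyad_Bp hspec a n k hk).comm _ (hfm hl).1 (hfm hl).2
  have i1 : ∀ x y, Dyadic01 x → Dyadic01 y → x < y → EA.le (f x) (pdyad EA CB a y) := by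
    intro x y hx hy hxy
    obtain ⟨n, k, l, hk, hl, rfl, rfl⟩ := dy_common hx hy
    rw [div_lt_div_iff_of_pos_right (by positivity)] at hxy
    refine lev_le (lev_fam hf n) (lev_pd hspec a n) ?_ (by exact_mod_cast hxy) hl
    intro k l hk hl
    exact inC_symm (pdyad_Bp hspec a n l hl).mem (hfm hk).1 (hc n l k hl hk)
  have i2 : ∀ x y, Dyadic01 x → Dyadic01 y → x < y → EA.le (pdyad EA CB a x) (f y) := by
    intro x y hx hy hxy
    obtain ⟨n, k, l, hk, hl, rfl, rfl⟩ := dy_common hx hy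
    rw [div_lt_div_iff_of_pos_right (by positivity)] at hxy
    exact lev_le (lev_pd hspec a n) (lev_fam hf n) (hc n) (by exact_mod_cast hxy) hl
  symm
  apply ratRes_eq
  refine ⟨(hf.1 lam h0 h1).1, ?_, ?_⟩
  · rintro _ ⟨μ, hμ, hlt, rfl⟩
    obtain ⟨ν, hν, n1, n2⟩ := exists_dyadic h0 hlt (dy_le_one hμ)
    exact le_trans (hf.2.1.2.2 lam ν h0 n1.le (dy_le_one hν)) (i1 ν μ hν hμ n2)
  · intro t ht hts
    refine (hf.2.2.1 lam h0 h1).2.2 t ht ?_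
    rintro _ ⟨μ, hlt, hμ, rfl⟩
    obtain ⟨ν, hν, n1, n2⟩ := exists_dyadic h0 hlt hμ
    obtain ⟨ν', hν', n1', n2'⟩ := exists_dyadic h0 n1 (dy_le_one hν)
    exact le_trans (hts _ ⟨ν', hν', n1', rfl⟩)
      (le_trans (i2 ν' ν hν' hν n2') (hf.2.1.2.2 ν μ (dy_nonneg hν) n2.le hμ))

end interleave

end EffectAlgebra


namespace EffectAlgebra

section existence

variable {E : Type u} {EA : EffectAlgebra E} {CB : CompressionBase EA}
local notation "ι" => EffectAlgebra.i EA

theorem J_nsmul {t y : E} (ht : t ∈ CB.P) (n : ℕ) {c : E} (h : n • ι y = ι c) :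
    n • ι (CB.J t y) = ι (CB.J t c) := by
  induction n generalizing c with
  | zero =>
    rw [zero_nsmul] at h ⊢
    have hc : c = EA.zero := i_inj (h.symm.trans i_zero.symm)
    rw [hc, J_zero ht]; rfl
  | succ n ih =>
    rw [succ_nsmul] at h ⊢
    obtain ⟨d, hd⟩ := def_left h
    rw [ih hd]
    rw [hd] at h
    exact J_add ht h

theorem FW_false {s y c : E} {j : ℕ} (h : FW EA s (List.replicate j false) y c) :
    (2 ^ j) • ι y = ι c := by
  induction j generalizing y with
  | zero => rw [← show y = c from h]; simp
  | succ j ih =>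
    obtain ⟨z, h1, h2⟩ := h
    have h3 : ι y + ι y = ι z := h1.1
    rw [← ih h2, ← h3, ← two_nsmul, ← mul_nsmul', pow_succ]

theorem fw_tail (hspec : Spectral EA CB) (a : E) (W Z : List Bool) {r : E} (hr : r ∈ CB.P)
    (h : EA.le r (uw EA CB a (W ++ Z))) :
    FW EA r Z (CB.J r (cw EA CB a W)) (CB.J r (cw EA CB a (W ++ Z))) := by
  have h1 := FW_restrict (uw_mem hspec a _) hr h (uInv hspec a (W ++ Z)).fw
  have h2 := FW_restrict (uw_mem hspec a _) hr (le_trans h (uw_append_le hspec a W Z))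
    (uInv hspec a W).fw
  rw [FW_append] at h1
  obtain ⟨y, h3, h4⟩ := h1
  rwa [FW_det h3 h2] at h4

theorem exists_word_cov (hspec : Spectral EA CB) (a : E) {lam : ℚ} (h : Dyadic01 lam)
    (h1 : lam < 1) : ∃ W, lamOf W = lam ∧ projCover EA CB (cw EA CB a W) = uw EA CB a W := by
  obtain ⟨n, k, hk, rfl⟩ := h
  by_cases h0 : k = 0
  · exact ⟨[], by subst h0; simp [lamOf], rfl⟩
  · rw [div_lt_one (by positivity)] at h1
    obtain ⟨w, hw⟩ := exists_snoc_true n k (by omega) (by exact_mod_cast h1)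
    exact ⟨w ++ [true], hw, (uw_step hspec a w (uInv hspec a w)).2.2.2⟩

theorem lamOf_replicate (j : ℕ) : lamOf (List.replicate j false) = 0 := by
  induction j with
  | zero => rfl
  | succ j ih => simp [List.replicate_succ, lamOf, ih]

theorem inf_dy (harch : EA.ArchimedeanEA) (hspec : Spectral EA CB) (a : E) {lam : ℚ}
    (h : Dyadic01 lam) :
    IsInfP EA CB {y | ∃ μ, Dyadic01 μ ∧ lam < μ ∧ y = pdyad EA CB a μ} (pdyad EA CB a lam) := by
  refine ⟨pd_mem hspec a h, ?_, ?_⟩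
  · rintro _ ⟨μ, hμ, hlt, rfl⟩
    exact pd_mono hspec a h hμ hlt.le
  intro t ht hts
  rcases eq_or_lt_of_le (dy_le_one h) with rfl | h1
  · rw [pd_one]; exact le_one t
  obtain ⟨W, rfl, hcov⟩ := exists_word_cov hspec a h h1
  have hts' : ∀ j, EA.le t (pdyad EA CB a (lamOf W + (1 / 2) ^ (W.length + j))) := by
    intro j
    refine hts _ ⟨_, ?_, ?_, rfl⟩
    · have := dy_lam' (W ++ List.replicate j false)
      rw [lamOf_append, lamOf_replicate] at this
      simpa using this
    · have : (0 : ℚ) < (1 / 2) ^ (W.length + j) := by positivity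
      linarith
  have hpd := pd_mem hspec a h
  have hWorth : EA.le (cw EA CB a W) (EA.compl (pdyad EA CB a (lamOf W))) :=
    le_trans (uInv hspec a W).le (orth_of_add' (pd_add hspec a W))
  have hJ : CB.J t (cw EA CB a W) = EA.zero := by
    apply arch_pow harch (m := 1) (by norm_num)
    intro j
    have hadd := pd_add hspec a (W ++ List.replicate j false)
    set V := W ++ List.replicate j false with hV
    have hlV : lamOf V = lamOf W := by rw [hV, lamOf_append, lamOf_replicate]; simp
    have hVl : V.length = W.length + j := by simp [hV]
    rw [hlV, hVl] at hadd
    have huV := uw_mem hspec a V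
    have h2 := J_padd hpd huV hadd (inC_of_orth hpd hWorth)
    rw [(J_zero_iff hpd).2 hWorth, i_zero, zero_add] at h2
    have h3 := fw_tail hspec a W (List.replicate j false) huV (le_refl _)
    have h4 := FW_false h3
    rw [← hV, i_inj h2] at h4
    have h5 := J_nsmul ht _ h4
    rw [J_J_of_le ht (P_add hpd huV hadd) (hts' j)] at h5
    rw [one_mul]
    exact ⟨_, h5⟩
  have h2 := cov_le hspec.1 (P_compl ht) ((J_zero_iff ht).1 hJ)
  rw [hcov] at h2
  have hadd := pd_add hspec a W
  rw [add_comm] at hadd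
  exact le_sub_of (uw_mem hspec a W) hadd (hts' 0) (le_compl_comm h2)

theorem rat_decomp {lam : ℚ} (h0 : 0 ≤ lam) (h1 : lam < 1) :
    ∃ (w v : List Bool) (l0 : ℚ), 0 < v.length ∧ lam = lamOf w + (1 / 2) ^ w.length * l0 ∧
      l0 = lamOf v + (1 / 2) ^ v.length * l0 ∧ 0 ≤ l0 ∧ l0 < 1 := by
  obtain ⟨N, hN⟩ : ∃ N : ℕ, (N : ℤ) = lam.num := ⟨lam.num.toNat, Int.toNat_of_nonneg (Rat.num_nonneg.2 h0)⟩
  set D := lam.den with hD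
  have hDpos : 0 < D := lam.den_pos
  have hDq : (0 : ℚ) < D := by exact_mod_cast hDpos
  have hlam : lam = (N : ℚ) / D := by
    have := Rat.num_div_den lam
    rw [← hN] at this
    rw [← this, hD]; simp
  have hND : N < D := by
    rw [hlam, div_lt_one hDq] at h1
    exact_mod_cast h1
  obtain ⟨k, m, hm, hkm⟩ : ∃ k m : ℕ, 0 < m ∧ (2 ^ k * N) % D = (2 ^ (k + m) * N) % D := by
    obtain ⟨k, l, hne, he⟩ := Finite.exists_ne_map_eq_of_infinite
      (fun k : ℕ => (⟨(2 ^ k * N) % D, Nat.mod_lt _ hDpos⟩ : Fin D))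
    have he' : (2 ^ k * N) % D = (2 ^ l * N) % D := by simpa using he
    rcases Nat.lt_or_gt_of_ne hne with h | h
    · exact ⟨k, l - k, by omega, by rw [show k + (l - k) = l by omega]; exact he'⟩
    · exact ⟨l, k - l, by omega, by rw [show l + (k - l) = k by omega]; exact he'.symm⟩
  set r := (2 ^ k * N) % D with hr
  have hrD : r < D := Nat.mod_lt _ hDpos
  have e1 : D * ((2 ^ k * N) / D) + r = 2 ^ k * N := Nat.div_add_mod _ _
  have hr2 : (2 ^ m * r) % D = r := by
    have h2 : (2 ^ m * r) % D = (2 ^ m * (2 ^ k * N)) % D := by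
      rw [hr, Nat.mul_mod, Nat.mod_mod, ← Nat.mul_mod]
    rw [h2, hkm, pow_add]
    congr 1; ring
  have e2 : D * ((2 ^ m * r) / D) + r = 2 ^ m * r := by
    have := Nat.div_add_mod (2 ^ m * r) D
    rwa [hr2] at this
  obtain ⟨w, hw, hnw⟩ := exists_word k ((2 ^ k * N) / D) (by
    rw [Nat.div_lt_iff_lt_mul hDpos]
    exact Nat.mul_lt_mul_of_pos_left hND (by positivity))
  obtain ⟨v, hv, hnv⟩ := exists_word m ((2 ^ m * r) / D) (by
    rw [Nat.div_lt_iff_lt_mul hDpos]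
    exact Nat.mul_lt_mul_of_pos_left hrD (by positivity))
  rw [← hnw] at e1
  rw [← hnv] at e2
  have e1q : (D : ℚ) * nv w + r = 2 ^ k * N := by exact_mod_cast e1
  have e2q : (D : ℚ) * nv v + r = 2 ^ m * r := by exact_mod_cast e2
  refine ⟨w, v, (r : ℚ) / D, by omega, ?_, ?_, by positivity, ?_⟩
  · rw [lamOf_eq, half_pow_eq, hw, hlam]
    field_simp
    linarith
  · rw [lamOf_eq, half_pow_eq, hv]
    field_simp
    linarith
  · rw [div_lt_one hDq]; exact_mod_cast hrD

theorem cut (hspec : Spectral EA CB) {s e g : E} {v : List Bool} (hs : s ∈ CB.P) (he : EA.le e s)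
    (h : FW EA s v e g) : ∃ p y z b, p ∈ CB.P ∧ ι g + ι z = ι b ∧ ι e + ι y = ι b ∧ EA.le y p ∧
      EA.le z (EA.compl p) ∧ EA.le y s ∧
      ∀ x ∈ CB.P, inC EA CB e x → inC EA CB s x → inC EA CB y x := by
  have hcomm : CommuteEl EA CB e g := by
    apply commuteEl_of
    intro p hp hep hb
    have hps := hb s hs (inC_of_le hs he)
    exact FW_inC hp (inC_symm hp hs hps) hep h
  obtain ⟨p, ⟨hpP, hp⟩, h1, h2⟩ := hspec.2.2 e g hcomm
  have hep : inC EA CB e p := hp e (by simp)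
  have hgp : inC EA CB g p := hp g (by simp)
  have hd := diff_of hep hgp h1 h2
  have hs1 := osub_spec h1
  have hs2 := osub_spec h2
  obtain ⟨b, hb⟩ : ∃ b, ι (CB.J p g) + ι (CB.J (EA.compl p) e) = ι b := by
    apply le_compl_iff.1
    have := compl_le_compl (J_le (P_compl hpP) e)
    rw [compl_compl] at this
    exact le_trans (J_le hpP g) this
  have hgz : ι g + ι (EA.osub (CB.J (EA.compl p) e) (CB.J (EA.compl p) g)) = ι b := by
    rw [← hb, ← hs2, ← inC_iff'.1 hgp, add_assoc]
  have hyJ := le_right hs1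
  refine ⟨p, _, _, b, hpP, hgz, hd.symm.trans hgz, le_trans hyJ (J_le hpP g),
    le_trans (le_right hs2) (J_le (P_compl hpP) e), ?_, ?_⟩
  · exact le_trans hyJ (le_trans ((inC_iff hpP).1 hgp) (FW_le he h))
  · intro x hx hex hsx
    have hgx := FW_inC hx hsx hex h
    have hxp : inC EA CB x p := hp x (Or.inl ⟨hx, by
      rintro q (rfl | rfl)
      · exact hex
      · exact hgx⟩)
    have hpx := inC_symm hx hpP hxp
    exact inC_sub hx (inC_J hx hpP hpx hex) (inC_J hx hpP hpx hgx) hs1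

theorem l0_vpow {v : List Bool} {l0 : ℚ} (h : l0 = lamOf v + (1 / 2) ^ v.length * l0) (j : ℕ) :
    l0 = lamOf (vpow v j) + (1 / 2) ^ (vpow v j).length * l0 := by
  induction j with
  | zero => simp [vpow, lamOf]
  | succ j ih =>
    simp only [vpow]
    rw [lamOf_append, List.length_append, pow_add]
    calc l0 = lamOf v + (1 / 2) ^ v.length * l0 := h
      _ = lamOf v + (1 / 2) ^ v.length *
        (lamOf (vpow v j) + (1 / 2) ^ (vpow v j).length * l0) := by rw [← ih]
      _ = _ := by ring

theorem split_at {Z : List Bool} {n m : ℕ} (h : Z.length = n + m) :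
    ∃ t z, Z = t ++ z ∧ t.length = n ∧ z.length = m := by
  refine ⟨Z.take n, Z.drop n, (List.take_append_drop n Z).symm, ?_, ?_⟩
  · rw [List.length_take, h]; simp
  · rw [List.length_drop, h]; simp

theorem inf_rat (harch : EA.ArchimedeanEA) (hspec : Spectral EA CB) (a : E) {lam : ℚ}
    (h0 : 0 ≤ lam) (h1 : lam < 1) :
    ∃ M, inC EA CB a M ∧
    IsInfP EA CB {y | ∃ μ, Dyadic01 μ ∧ lam < μ ∧ y = pdyad EA CB a μ} M := by
  obtain ⟨w', v, l0, hv, hlam, hl0, hl00, hl01⟩ := rat_decomp h0 h1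
  set W := w' ++ v with hW
  have hlamW : lam = lamOf W + (1 / 2) ^ W.length * l0 := by
    rw [hW, lamOf_append, List.length_append, pow_add, hlam]
    calc lamOf w' + (1 / 2) ^ w'.length * l0
        = lamOf w' + (1 / 2) ^ w'.length * (lamOf v + (1 / 2) ^ v.length * l0) := by rw [← hl0]
      _ = _ := by ring
  set s := uw EA CB a W with hsdef
  set g := cw EA CB a W with hg
  have hs : s ∈ CB.P := uw_mem hspec a W
  obtain ⟨e, he1, he2⟩ : ∃ e, FW EA s w' (CB.J s a) e ∧ FW EA s v e g := by
    have := (uInv hspec a W).fw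
    rw [← hsdef, ← hg] at this
    rwa [hW, FW_append] at this
  have hes : EA.le e s := FW_le (J_le hs a) he1
  obtain ⟨p, y, z, b, hp, hgz, hey, hyp, hzp, hys, hyc⟩ := cut hspec hs hes he2
  have hscom : ∀ x ∈ CB.P, inC EA CB a x → inC EA CB s x := fun x hx hax =>
    uw_comm hspec a W hx hax
  have hycom : ∀ x ∈ CB.P, inC EA CB a x → inC EA CB y x := fun x hx hax =>
    hyc x hx (FW_inC hx (hscom x hx hax) (inC_J hx hs (hscom x hx hax) hax) he1) (hscom x hx hax)
  set K := projCover EA CB y with hK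
  have hKP : K ∈ CB.P := cov_mem hspec.1 y
  have hyK : EA.le y K := le_cov hspec.1 y
  have hKs : EA.le K s := cov_le hspec.1 hs hys
  have hKp : EA.le K p := cov_le hspec.1 hp hyp
  have hKcom : ∀ x ∈ CB.P, inC EA CB a x → inC EA CB K x := fun x hx hax =>
    inC_cov hspec.1 hx (hycom x hx hax)
  have hadd := pd_add hspec a W
  rw [← hsdef] at hadd
  have hdW := dy_lam W
  have hdW' := dy_lam' W
  have hpd := pd_mem hspec a hdW
  have htop := pd_mem hspec a hdW'
  set Q := EA.osub s K with hQ
  have hKQ : ι K + ι Q = ι s := osub_spec hKs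
  have hQP : Q ∈ CB.P := P_sub hKP hs hKQ
  have hQs : EA.le Q s := le_right hKQ
  have hQcom : ∀ x ∈ CB.P, inC EA CB a x → inC EA CB Q x := fun x hx hax =>
    inC_sub hx (hKcom x hx hax) (hscom x hx hax) hKQ
  obtain ⟨M, hM⟩ : ∃ M, ι (pdyad EA CB a (lamOf W)) + ι Q = ι M := by
    refine def_right (x := ι K) (c := pdyad EA CB a (lamOf W + (1 / 2) ^ W.length)) ?_
    rw [← hadd, ← hKQ]; abel
  have hKM : ι K + ι M = ι (pdyad EA CB a (lamOf W + (1 / 2) ^ W.length)) := by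
    rw [← hM, ← hadd, ← hKQ]; abel
  have hMP : M ∈ CB.P := P_add hpd hQP hM
  have hMcom : ∀ x ∈ CB.P, inC EA CB a x → inC EA CB M x := fun x hx hax =>
    inC_add hx (pd_comm hspec a hdW hx hax) (hQcom x hx hax) hM
  have hWpos : (0 : ℚ) < (1 / 2) ^ W.length := by positivity
  have hWlam : lamOf W ≤ lam := by
    rw [hlamW]; have := mul_nonneg hWpos.le hl00; linarith
  -- the restriction facts
  have hrv : ∀ r ∈ CB.P, EA.le r s → FW EA r v (CB.J r e) (CB.J r g) := fun r hr hrs =>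
    FW_J hr hrs he2
  refine ⟨M, inC_of_bicomm' hspec.2.1 hMP hMcom, hMP, ?_, ?_⟩
  · rintro _ ⟨μ, hμ, hlt, rfl⟩
    refine principal (pd_mem hspec a hμ) (pd_mono hspec a hdW hμ (by linarith)) ?_ hM
    obtain ⟨n, k, hk, rfl⟩ := hμ
    have hkn : k ≤ 2 ^ n := by exact_mod_cast hk
    obtain ⟨c, hc⟩ : ∃ c, W.length + n * v.length = n + c :=
      ⟨W.length + n * v.length - n, by
        have := Nat.le_mul_of_pos_right n hv
        omega⟩
    have hμe : (k : ℚ) / 2 ^ n = ((k * 2 ^ c : ℕ) : ℚ) / 2 ^ (n + c) := by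
      push_cast; rw [pow_add]; field_simp
    rw [hμe]
    apply le_pd hspec a
    · rw [pow_add]; exact Nat.mul_le_mul_right _ hkn
    intro Z' hZ' hkZ
    rw [← hc] at hZ'
    have hZlam : lam < lamOf Z' := by
      refine lt_of_lt_of_le hlt ?_
      rw [hμe, lamOf_eq, hZ', hc]
      gcongr
    obtain ⟨W1, Z, rfl, hW1, hZ⟩ := split_at hZ'
    by_cases hWW : W1 = W
    · subst hWW
      have hu := uw_mem hspec a (W ++ Z)
      have hcu := hQcom _ hu (uw_inC hspec a (W ++ Z))
      have hr := (J_comp hQP hu hcu).1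
      have hrQ := J_le hQP (uw EA CB a (W ++ Z))
      have hru := meet_le_right hQP hu hcu
      rw [← J_zero_iff' hQP]
      set r := CB.J Q (uw EA CB a (W ++ Z)) with hrdef
      have hrs := le_trans hrQ hQs
      have hKr : EA.le K (EA.compl r) :=
        le_trans (orth_of_add hKQ) (compl_le_compl hrQ)
      have hy0 : CB.J r y = EA.zero := (J_zero_iff hr).2 (le_trans hyK hKr)
      have e1 := J_add hr hgz
      rw [← J_add hr hey, hy0, i_zero, add_zero] at e1
      refine FW_below hv hl0 hl00 hl01 (J_le hr e) (hrv r hr hrs) (le_left e1) hZ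
        (fw_tail hspec a W Z hr hru) ?_
      rw [hlamW, lamOf_append W Z] at hZlam
      have := lt_of_add_lt_add_left hZlam
      exact lt_of_mul_lt_mul_left this hWpos.le
    · refine le_trans hQs (le_trans (uw_orth hspec a hW1.symm (Ne.symm hWW)) ?_)
      exact compl_le_compl (uw_append_le hspec a W1 Z)
  · intro t ht hts
    have hts' : ∀ μ, Dyadic01 μ → lam < μ → EA.le t (pdyad EA CB a μ) := fun μ hμ hlt =>
      hts _ ⟨μ, hμ, hlt, rfl⟩
    have hJ : CB.J t y = EA.zero := by
      apply arch_pow harch hv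
      intro j
      set V := W ++ vpow v j with hV
      have hVl : V.length = W.length + j * v.length := by
        rw [hV, List.length_append, vpow_length]
      have haddV := pd_add hspec a V
      have hdV := dy_lam V
      have hpdV := pd_mem hspec a hdV
      have huV := uw_mem hspec a V
      have hlamV : lam < lamOf V + (1 / 2) ^ V.length := by
        have h2 := l0_vpow hl0 j
        have h3 : (0 : ℚ) < (1 / 2) ^ (vpow v j).length := by positivity
        have h4 : lamOf V = lamOf W + (1 / 2) ^ W.length * lamOf (vpow v j) :=
          lamOf_append W (vpow v j)
        have h5 : ((1 : ℚ) / 2) ^ V.length = (1 / 2) ^ W.length * (1 / 2) ^ (vpow v j).length := by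
          rw [hVl, vpow_length, pow_add]
        have h6 : l0 < lamOf (vpow v j) + (1 / 2) ^ (vpow v j).length := by nlinarith
        have h7 := mul_lt_mul_of_pos_left h6 hWpos
        rw [h4, h5, hlamW]
        linarith
      have horth : EA.le (pdyad EA CB a (lamOf V)) (EA.compl K) := by
        rw [lamOf_eq]
        apply orth_pd hspec a (nv_lt V).le hKP (le_trans hKs (uw_append_le hspec a [] W))
        intro Z' hZ' hlt
        obtain ⟨W1, Z, rfl, hW1, hZ⟩ := split_at (hZ'.trans hVl)
        by_cases hWW : W1 = W
        · subst hWW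
          have hu := uw_mem hspec a (W ++ Z)
          have hcu := hKcom _ hu (uw_inC hspec a (W ++ Z))
          have hr := (J_comp hKP hu hcu).1
          have hrK := J_le hKP (uw EA CB a (W ++ Z))
          have hru := meet_le_right hKP hu hcu
          rw [← J_zero_iff' hKP]
          set r := CB.J K (uw EA CB a (W ++ Z)) with hrdef
          have hrs := le_trans hrK hKs
          have hz0 : CB.J r z = EA.zero :=
            (J_zero_iff hr).2 (le_trans hzp (compl_le_compl (le_trans hrK hKp)))
          have e1 := J_add hr hey
          rw [← J_add hr hgz, hz0, i_zero, add_zero] at e1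
          have hge : CB.J r g = CB.J r e := by
            refine FW_above (J_le hr e) (hrv r hr hrs) (le_left e1) hZ
              (fw_tail hspec a W Z hr hru) ?_
            rw [lamOf_lt_iff (by rw [hZ, vpow_length])]
            have n1 := nv_append W Z
            have n2 := nv_append W (vpow v j)
            rw [hZ] at n1
            rw [vpow_length] at n2
            rw [hV, n1, n2] at hlt
            omega
          have hy0 : CB.J r y = EA.zero := by
            rw [hge] at e1
            have e2 : ι (CB.J r e) + 0 = ι (CB.J r e) := add_zero _
            have e3 := t_cancel e1 e2
            exact i_inj e3
          have hKr := cov_le hspec.1 (P_compl hr) ((J_zero_iff hr).1 hy0)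
          exact sharp hr (le_refl r) (le_trans hrK hKr)
        · refine le_trans hKs (le_trans (uw_orth hspec a hW1.symm (Ne.symm hWW)) ?_)
          exact compl_le_compl (uw_append_le hspec a W1 Z)
      have h2 := J_padd hpdV huV haddV (hycom _ hpdV (pd_inC hspec a hdV))
      rw [(J_zero_iff' hpdV).2 (le_trans horth (compl_le_compl hyK)), i_zero, zero_add] at h2
      have hcu := inC_symm hKP huV (hKcom _ huV (uw_inC hspec a V))
      have hr := (J_comp huV hKP hcu).1
      have hru := J_le huV K
      have hrK := meet_le_right huV hKP hcu
      have hyr := J_eq_of_le huV hKP hcu hyK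
      set r := CB.J (uw EA CB a V) K with hrdef
      have hz0 : CB.J r z = EA.zero :=
        (J_zero_iff hr).2 (le_trans hzp (compl_le_compl (le_trans hrK hKp)))
      have e1 := J_add hr hey
      rw [← J_add hr hgz, hz0, i_zero, add_zero] at e1
      obtain ⟨d, hd⟩ := FW_multiple (hrv r hr (le_trans hrK hKs)) e1
        (fw_tail hspec a W (vpow v j) hr hru)
      have h3 := J_nsmul ht _ hd
      rw [hyr, i_inj h2, J_J_of_le ht (pd_mem hspec a (dy_lam' V)) (hts' _ (dy_lam' V) hlamV)] at h3
      exact ⟨_, h3⟩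
    have hKt := cov_le hspec.1 (P_compl ht) ((J_zero_iff ht).1 hJ)
    refine le_sub_of hKP hKM (hts' _ hdW' ?_) (le_compl_comm hKt)
    rw [hlamW]
    have := mul_lt_mul_of_pos_left hl01 hWpos
    linarith

theorem inf_all (harch : EA.ArchimedeanEA) (hspec : Spectral EA CB) (a : E) {lam : ℚ}
    (h0 : 0 ≤ lam) (h1 : lam ≤ 1) : inC EA CB a (ratRes EA CB a lam) ∧
    IsInfP EA CB {y | ∃ μ, Dyadic01 μ ∧ lam < μ ∧ y = pdyad EA CB a μ} (ratRes EA CB a lam) := by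
  rcases eq_or_lt_of_le h1 with rfl | h1
  · have := inf_dy harch hspec a dy_one
    rw [ratRes_eq this]
    exact ⟨pd_inC hspec a dy_one, this⟩
  · obtain ⟨M, hM1, hM2⟩ := inf_rat harch hspec a h0 h1
    rw [ratRes_eq hM2]
    exact ⟨hM1, hM2⟩

theorem fam_ratRes (harch : EA.ArchimedeanEA) (hspec : Spectral EA CB) (a : E) {f : ℚ → E}
    (hf : ∀ lam : ℚ, 0 ≤ lam → lam ≤ 1 → f lam = ratRes EA CB a lam) : Fam EA CB a f := by
  have hdy : ∀ x, Dyadic01 x → f x = pdyad EA CB a x := fun x hx => by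
    rw [hf x (dy_nonneg hx) (dy_le_one hx), ratRes_eq (inf_dy harch hspec a hx)]
  have hinf : ∀ lam : ℚ, 0 ≤ lam → lam ≤ 1 → IsInfP EA CB
      {y | ∃ μ, Dyadic01 μ ∧ lam < μ ∧ y = pdyad EA CB a μ} (f lam) := fun lam h0 h1 => by
    rw [hf lam h0 h1]; exact (inf_all harch hspec a h0 h1).2
  have hmono : ∀ lam mu : ℚ, 0 ≤ lam → lam ≤ mu → mu ≤ 1 → EA.le (f lam) (f mu) := by
    intro lam mu h0 hle h1
    refine (hinf mu (h0.trans hle) h1).2.2 _ (hinf lam h0 (hle.trans h1)).1 ?_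
    rintro _ ⟨μ, hμ, hlt, rfl⟩
    exact (hinf lam h0 (hle.trans h1)).2.1 _ ⟨μ, hμ, lt_of_le_of_lt hle hlt, rfl⟩
  refine ⟨?_, ⟨?_, ?_, hmono⟩, ?_, ?_⟩
  · intro lam h0 h1
    refine ⟨(hinf lam h0 h1).1, ?_⟩
    rw [hf lam h0 h1]; exact (inf_all harch hspec a h0 h1).1
  · rw [hdy 0 dy_zero, pd_zero]; exact compl_le_compl (le_cov hspec.1 a)
  · rw [hdy 1 dy_one, pd_one]
  · intro lam h0 h1
    refine ⟨(hinf lam h0 h1).1, ?_, ?_⟩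
    · rintro _ ⟨μ, hlt, hμ, rfl⟩
      exact hmono lam μ h0 hlt.le hμ
    · intro t ht hts
      refine (hinf lam h0 h1).2.2 t ht ?_
      rintro _ ⟨μ, hμ, hlt, rfl⟩
      rw [← hdy μ hμ]
      exact hts _ ⟨μ, hlt, dy_le_one hμ, rfl⟩
  · intro w
    rw [hdy _ (dy_lam w), hdy _ (dy_lam' w),
      pmeet_diff (pd_mem hspec a (dy_lam w)) (pd_mem hspec a (dy_lam' w)) (pd_add hspec a w)]
    exact ⟨_, (fword_iff (J_le (uw_mem hspec a w) a)).2 (uInv hspec a w).fw⟩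

end existence

end EffectAlgebra

open EffectAlgebra in
/-- in an archimedean spectral effect algebra, the rational spectral
resolution of `a` is the unique family `{p_λ}_{λ∈ℚ∩[0,1]}` such that:
(i) `p_λ ∈ PC(a)`; (ii) `p_0 ≤ a'`, `p_1 = 1`, monotone;
(iii) `⋀_{λ<μ} p_μ = p_λ`; (iv) with `u_w := p_{λ(w+1)} ∧ p_{λ(w)}'`, the element
`f_w(J_{u_w}(a))` exists in `[0,u_w]`. -/
theorem statement14 {E : Type u} (EA : EffectAlgebra E) (CB : CompressionBase EA)
    (harch : EA.ArchimedeanEA) (hspec : Spectral EA CB) (a : E) (f : ℚ → E) :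
    ((∀ lam : ℚ, 0 ≤ lam → lam ≤ 1 → f lam ∈ PC EA CB a) ∧
      (EA.le (f 0) (EA.compl a) ∧ f 1 = EA.one ∧
        ∀ lam mu : ℚ, 0 ≤ lam → lam ≤ mu → mu ≤ 1 → EA.le (f lam) (f mu)) ∧
      (∀ lam : ℚ, 0 ≤ lam → lam ≤ 1 →
        IsInfP EA CB {y | ∃ μ : ℚ, lam < μ ∧ μ ≤ 1 ∧ y = f μ} (f lam)) ∧
      (∀ w : List Bool,
        ∃ b : E, fword EA
          (pmeet EA CB (f (lamOf w + (1 / 2) ^ w.length)) (EA.compl (f (lamOf w)))) w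
          (CB.J (pmeet EA CB (f (lamOf w + (1 / 2) ^ w.length))
            (EA.compl (f (lamOf w)))) a) = some b)) ↔
      (∀ lam : ℚ, 0 ≤ lam → lam ≤ 1 → f lam = ratRes EA CB a lam) := by
  change Fam EA CB a f ↔ _
  constructor
  · intro hf lam h0 h1
    exact fam_unique hspec (a := a) (f := f) hf h0 h1
  · intro hf
    exact fam_ratRes harch hspec a hf
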